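/- arXiv:0908.1544 — 5 statements merged into one kernel-verified Lean document; each statement's English description precedes it below -/
import Mathlib

section
/- Let Ȧ ⊆ Ḣ and Ä ⊆ Ḧ be analytic sets and let A : Ȧ → Ä be a function that is analytic as a subset of Ȧ × Ä. Then either the graph of A can be covered by countably many graphs of continuous functions, or else there exist maps φ̇ : ω^ω → Ȧ and φ̈ : ω^ω → Ä such that A ∘ φ̇ = φ̈ ∘ P (i.e., A(φ̇(s)) = φ̈(s) for every s ∈ ω^ω), φ̇ is a topological embedding of ω^ω with the Cantor topology into Ȧ, and φ̈ is a topological embedding of ω^ω with the Baire topology into Ä. -/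
open MeasureTheory Metric Set Topology

noncomputable section

/-- The Hilbert cube `[0,1]^ℕ`. -/
abbrev Hcube : Type := ℕ → unitInterval

/-- `G` is the graph of a continuous function, i.e. a set of the form
`{(x, f x) : x ∈ D}` where `f` is continuous on its domain `D ⊆ Ḣ`. -/
def IsContGraph (G : Set (Hcube × Hcube)) : Prop :=
  ∃ (D : Set Hcube) (f : Hcube → Hcube), ContinuousOn f D ∧
    G = {p : Hcube × Hcube | p.1 ∈ D ∧ p.2 = f p.1}

/-- `X` can be covered by countably many graphs of continuous functions. -/
def CoveredByCtsGraphs (X : Set (Hcube × Hcube)) : Prop :=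
  ∃ G : ℕ → Set (Hcube × Hcube), (∀ n, IsContGraph (G n)) ∧ X ⊆ ⋃ n, G n

/-- The identification of `ω` with `{0} ∪ {2^{-n} : n ≥ 1} ⊆ [0,1]`:
`0 ↦ 0` and `n ↦ 2^{-n}` for `n ≥ 1`. -/
def cantorEmbNat : ℕ → ℝ := fun n => if n = 0 then 0 else (2 : ℝ) ^ (-(n : ℤ))

/-- The Cantor topology on `ω^ω`, induced by the coordinatewise identification of `ω`
with `{0} ∪ {2^{-n} : n ≥ 1}` and the product topology. -/
def cantorTop : TopologicalSpace (ℕ → ℕ) :=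
  TopologicalSpace.induced (fun (s : ℕ → ℕ) (n : ℕ) => cantorEmbNat (s n)) inferInstance

section core
open Filter

/-- sigma-continuity on a set -/
def SmallSet {Ω Y : Type} [TopologicalSpace Ω] [TopologicalSpace Y] (A : Ω → Y) (D : Set Ω) : Prop :=
  ∃ E : ℕ → Set Ω, D ⊆ ⋃ n, E n ∧ ∀ n, ContinuousOn A (E n)

theorem SmallSet.mono {Ω Y : Type} [TopologicalSpace Ω] [TopologicalSpace Y] {A : Ω → Y} {D D' : Set Ω}
    (h : SmallSet A D) (h' : D' ⊆ D) : SmallSet A D' := by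
  obtain ⟨E, h1, h2⟩ := h
  exact ⟨E, h'.trans h1, h2⟩

theorem SmallSet.iUnion {Ω Y ι : Type} [Countable ι] [TopologicalSpace Ω] [TopologicalSpace Y] {A : Ω → Y}
    {D : ι → Set Ω} (h : ∀ i, SmallSet A (D i)) : SmallSet A (⋃ i, D i) := by
  rcases isEmpty_or_nonempty ι with hι | hι
  · exact ⟨fun _ => ∅, by simp, fun n => by simp⟩
  obtain ⟨g, hg⟩ := exists_surjective_nat ι
  choose E h1 h2 using h
  refine ⟨fun n => E (g n.unpair.1) n.unpair.2, ?_, fun n => h2 _ _⟩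
  intro x hx
  obtain ⟨i, hi⟩ := mem_iUnion.1 hx
  obtain ⟨m, hm⟩ := mem_iUnion.1 (h1 i hi)
  obtain ⟨k, rfl⟩ := hg i
  exact mem_iUnion.2 ⟨Nat.pair k m, by simpa using hm⟩

theorem SmallSet.union {Ω Y : Type} [TopologicalSpace Ω] [TopologicalSpace Y] {A : Ω → Y}
    {D D' : Set Ω} (h : SmallSet A D) (h' : SmallSet A D') : SmallSet A (D ∪ D') := by
  rw [union_eq_iUnion]
  exact SmallSet.iUnion (fun b => by cases b <;> assumption)

theorem SmallSet.of_cont {Ω Y : Type} [TopologicalSpace Ω] [TopologicalSpace Y] {A : Ω → Y}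
    {D : Set Ω} (h : ContinuousOn A D) : SmallSet A D :=
  ⟨fun _ => D, fun x hx => mem_iUnion.2 ⟨0, hx⟩, fun _ => h⟩

theorem SmallSet.fiber {Ω Y : Type} [TopologicalSpace Ω] [TopologicalSpace Y] (A : Ω → Y)
    (p : Y) : SmallSet A {x | A x = p} := by
  apply SmallSet.of_cont
  exact (continuousOn_const (c := p)).congr (fun x hx => hx)

/-- essential closure of the graph of `g` -/
def ecl {Ω Y L : Type} [TopologicalSpace Ω] [TopologicalSpace Y] [TopologicalSpace L]
    (A : Ω → Y) (g : Ω → L) (x : Ω) (e : L) : Prop :=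
  ∀ V ∈ 𝓝 x, ∀ U ∈ 𝓝 e, ¬ SmallSet A {x' | x' ∈ V ∧ g x' ∈ U}

theorem small_not_ecl {Ω Y L : Type} [TopologicalSpace Ω] [TopologicalSpace Y] [TopologicalSpace L]
    [SecondCountableTopology Ω] [SecondCountableTopology L]
    (A : Ω → Y) (g : Ω → L) : SmallSet A {x | ¬ ecl A g x (g x)} := by
  let T := {p : TopologicalSpace.countableBasis Ω × TopologicalSpace.countableBasis L //
    SmallSet A {x' | x' ∈ p.1.1 ∧ g x' ∈ p.2.1}}
  haveI : Countable (TopologicalSpace.countableBasis Ω) :=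
    (TopologicalSpace.countable_countableBasis Ω).to_subtype
  haveI : Countable (TopologicalSpace.countableBasis L) :=
    (TopologicalSpace.countable_countableBasis L).to_subtype
  have h : SmallSet A (⋃ p : T, {x' | x' ∈ p.1.1.1 ∧ g x' ∈ p.1.2.1}) :=
    SmallSet.iUnion (fun p => p.2)
  refine h.mono ?_
  intro x hx
  simp only [mem_setOf_eq, ecl] at hx
  push Not at hx
  obtain ⟨V, hV, U, hU, hs⟩ := hx
  obtain ⟨V', hV', hxV, hVV⟩ := (TopologicalSpace.isBasis_countableBasis Ω).mem_nhds_iff.1 hV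
  obtain ⟨U', hU', hxU, hUU⟩ := (TopologicalSpace.isBasis_countableBasis L).mem_nhds_iff.1 hU
  refine mem_iUnion.2 ⟨⟨(⟨V', hV'⟩, ⟨U', hU'⟩), hs.mono ?_⟩, hxV, hxU⟩
  rintro y ⟨h1, h2⟩
  exact ⟨hVV h1, hUU h2⟩

/-- nearness of order `n` -/
def Near {K : Type} [MetricSpace K] (n : ℕ) (e e' : Finset ℕ → K) : Prop :=
  ∀ S ∈ (Finset.range n).powerset, dist (e S) (e' S) < 1 / ((n : ℝ) + 1)

theorem exists_near {K : Type} [MetricSpace K] (e : Finset ℕ → K) {U : Set (Finset ℕ → K)}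
    (N : ℕ) (η : ℝ) (hη : 0 < η)
    (h : ∀ e', (∀ S ∈ (Finset.range N).powerset, dist (e' S) (e S) < η) → e' ∈ U) :
    ∃ n, ∀ e', Near n e' e → e' ∈ U := by
  obtain ⟨m, hm⟩ := exists_nat_one_div_lt hη
  refine ⟨max N m, fun e' he' => h e' fun S hS => ?_⟩
  have h1 := he' S (by
    simp only [Finset.mem_powerset] at hS ⊢
    exact hS.trans (Finset.range_mono (le_max_left _ _)))
  refine h1.trans (lt_of_le_of_lt ?_ hm)
  apply one_div_le_one_div_of_le (by positivity)
  have : (m : ℝ) ≤ ((max N m : ℕ) : ℝ) := by exact_mod_cast le_max_right _ _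
  linarith

/-- good points -/
def GoodPt {Ω Y K : Type} [TopologicalSpace Ω] [TopologicalSpace Y] [MetricSpace K]
    (A : Ω → Y) (α : K → Y) (n : ℕ) (g : Ω → Finset ℕ → K) (x : Ω) (e : Finset ℕ → K) : Prop :=
  Near n e (g x) ∧ ecl A g x e ∧ α (e ∅) ≠ A x

theorem small_bad {Ω Y K : Type} [TopologicalSpace Ω] [SecondCountableTopology Ω]
    [TopologicalSpace Y] [MetricSpace K] [CompactSpace K]
    (A : Ω → Y) (α : K → Y) (hα : Continuous α) (n : ℕ) (g : Ω → Finset ℕ → K)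
    (hg : ∀ x, α (g x ∅) = A x) :
    SmallSet A {x | ¬ ∃ e, GoodPt A α n g x e} := by
  set η : ℝ := 1 / ((n : ℝ) + 1) with hηd
  have hη : 0 < η := by positivity
  let Bn : (Finset ℕ → K) → Set (Finset ℕ → K) := fun e =>
    {e' | ∀ S ∈ (Finset.range n).powerset, dist (e' S) (e S) < η / 4}
  have hB : ∀ e, Bn e ∈ 𝓝 e := by
    intro e
    refine (Finset.eventually_all _).2 ?_
    intro S _
    have : Tendsto (fun e' : Finset ℕ → K => dist (e' S) (e S)) (𝓝 e) (𝓝 (dist (e S) (e S))) :=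
      Continuous.tendsto (by fun_prop) e
    rw [dist_self] at this
    exact this.eventually (gt_mem_nhds (by positivity))
  obtain ⟨T, hTc, hT⟩ := TopologicalSpace.countable_cover_nhds hB
  haveI := hTc.to_subtype
  have h1 := small_not_ecl A g
  have h2 : SmallSet A (⋃ e : T, {x | g x ∈ Bn e ∧ ecl A g x (g x) ∧ ¬ ∃ e, GoodPt A α n g x e}) := by
    apply SmallSet.iUnion
    rintro ⟨e0, he0⟩
    apply SmallSet.of_cont
    intro x hx
    rw [ContinuousWithinAt, tendsto_iff_ultrafilter]
    intro F hF
    have hF1 : (F : Filter Ω) ≤ 𝓝 x := hF.trans nhdsWithin_le_nhds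
    have hF2 : ∀ᶠ y in (F : Filter Ω), g y ∈ Bn e0 ∧ ecl A g y (g y) ∧ ¬ ∃ e, GoodPt A α n g y e :=
      hF self_mem_nhdsWithin
    obtain ⟨e, -, he⟩ := isCompact_univ.ultrafilter_le_nhds (F.map g) (by simp)
    have he' : Tendsto g F (𝓝 e) := he
    have hecl : ecl A g x e := by
      intro V hV U hU
      have a1 : ∀ᶠ y in (F : Filter Ω), y ∈ interior V := hF1 (interior_mem_nhds.2 hV)
      have a2 : ∀ᶠ y in (F : Filter Ω), g y ∈ interior U := he' (interior_mem_nhds.2 hU)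
      obtain ⟨y, ⟨y1, y2⟩, y3⟩ := ((a1.and a2).and hF2).exists
      have := y3.2.1 (interior V) (isOpen_interior.mem_nhds y1) (interior U) (isOpen_interior.mem_nhds y2)
      intro hs
      apply this
      exact hs.mono (fun z hz => ⟨interior_subset hz.1, interior_subset hz.2⟩)
    have hnear : Near n e (g x) := by
      intro S hS
      have b1 : Tendsto (fun y => dist (g y S) (e0 S)) F (𝓝 (dist (e S) (e0 S))) :=
        ((((continuous_apply S).tendsto e).comp he').dist tendsto_const_nhds)
      have b2 : dist (e S) (e0 S) ≤ η / 4 :=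
        le_of_tendsto b1 (hF2.mono fun y hy => (hy.1 S hS).le)
      have b3 := hx.1 S hS
      have b4 := dist_triangle_right (e S) (g x S) (e0 S)
      have : dist (e S) (g x S) < η := by linarith
      exact this
    have hA : α (e ∅) = A x := by
      by_contra hne
      exact hx.2.2 ⟨e, hnear, hecl, hne⟩
    have : Tendsto (fun y => α (g y ∅)) F (𝓝 (α (e ∅))) :=
      (hα.tendsto _).comp (((continuous_apply ∅).tendsto e).comp he')
    rw [hA] at this
    simpa only [hg] using this
  refine (h1.union h2).mono ?_
  intro x hx
  by_cases hxe : ecl A g x (g x)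
  · right
    have : g x ∈ ⋃ e ∈ T, Bn e := by rw [hT]; trivial
    simp only [mem_iUnion] at this ⊢
    obtain ⟨e, he, hxe'⟩ := this
    exact ⟨⟨e, he⟩, hxe', hxe, hx⟩
  · left; exact hxe

open Classical in
/-- jump selector -/
def Rsel {Ω Y K : Type} [TopologicalSpace Ω] [TopologicalSpace Y] [MetricSpace K]
    (A : Ω → Y) (α : K → Y) (n : ℕ) (g : Ω → Finset ℕ → K) (x : Ω) : Finset ℕ → K :=
  if h : ∃ e, GoodPt A α n g x e then h.choose else g x

/-- iterated jump functions -/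
def GG {Ω Y K : Type} [TopologicalSpace Ω] [TopologicalSpace Y] [MetricSpace K]
    (A : Ω → Y) (α : K → Y) (G : Ω → K) (v : ℕ →₀ ℕ) : ℕ → Ω → Finset ℕ → K
  | 0 => fun x _ => G x
  | k + 1 => fun x S => if k ∈ S then Rsel A α (v k) (GG A α G v k) x (S.erase k)
      else GG A α G v k x S

section
variable {Ω Y K : Type} [TopologicalSpace Ω] [SecondCountableTopology Ω]
    [TopologicalSpace Y] [MetricSpace K] [CompactSpace K]
    (A : Ω → Y) (α : K → Y) (G : Ω → K)

theorem GG_empty (v : ℕ →₀ ℕ) (k : ℕ) (x : Ω) : GG A α G v k x ∅ = G x := by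
  induction k with
  | zero => rfl
  | succ k ih => simp [GG, ih]

theorem GG_congr (v v' : ℕ →₀ ℕ) (k : ℕ) (h : ∀ j < k, v j = v' j) :
    GG A α G v k = GG A α G v' k := by
  induction k with
  | zero => rfl
  | succ k ih =>
    have := ih (fun j hj => h j (by omega))
    simp only [GG, this, h k (by omega)]

theorem GG_level (v : ℕ →₀ ℕ) (k k' : ℕ) (hk : k ≤ k') (x : Ω) (S : Finset ℕ)
    (hS : ∀ s ∈ S, s < k) : GG A α G v k' x S = GG A α G v k x S := by
  induction k', hk using Nat.le_induction with
  | base => rfl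
  | succ m hm ih =>
    rw [← ih]
    have : m ∉ S := fun h => by have := hS m h; omega
    simp [GG, this]

theorem GG_split (v : ℕ →₀ ℕ) (i k' : ℕ) (hk : i < k') (x : Ω) (S : Finset ℕ)
    (hS : ∀ s ∈ S, s < i) :
    GG A α G v k' x (insert i S) = Rsel A α (v i) (GG A α G v i) x S := by
  rw [GG_level A α G v (i + 1) k' hk]
  · have : i ∉ S := fun h => by have := hS i h; omega
    simp [GG, this]
  · intro s hs
    rcases Finset.mem_insert.1 hs with rfl | hs
    · omega
    · have := hS s hs; omega

/-- the set of points where all jump functions are good -/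
def DD : Set Ω := {x | ∀ (v : ℕ →₀ ℕ) (k n : ℕ), ∃ e, GoodPt A α n (GG A α G v k) x e}

theorem DD_small (hα : Continuous α) (hG : ∀ x, α (G x) = A x) : SmallSet A (DD A α G)ᶜ := by
  have : SmallSet A (⋃ p : (ℕ →₀ ℕ) × ℕ × ℕ,
      {x | ¬ ∃ e, GoodPt A α p.2.2 (GG A α G p.1 p.2.1) x e}) := by
    apply SmallSet.iUnion
    rintro ⟨v, k, n⟩
    apply small_bad A α hα
    intro x
    rw [GG_empty, hG]
  refine this.mono ?_
  intro x hx
  simp only [DD, mem_compl_iff, mem_setOf_eq] at hx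
  push Not at hx
  obtain ⟨v, k, n, h⟩ := hx
  refine mem_iUnion.2 ⟨(v, k, n), ?_⟩
  simpa using h

theorem Rsel_good {x : Ω} (hx : x ∈ DD A α G) (v : ℕ →₀ ℕ) (k n : ℕ) :
    GoodPt A α n (GG A α G v k) x (Rsel A α n (GG A α G v k) x) := by
  have h := hx v k n
  rw [Rsel, dif_pos h]
  exact h.choose_spec

theorem exists_split (hα : Continuous α) (hG : ∀ x, α (G x) = A x) {x : Ω} (hx : x ∈ DD A α G)
    (v : ℕ →₀ ℕ) (k n : ℕ) (V : Set Ω) (hV : V ∈ 𝓝 x) (N : ℕ) (η : ℝ) (hη : 0 < η)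
    (Φ : Set Y) (hΦ : Φ.Finite) :
    ∃ y ∈ DD A α G, y ∈ V ∧ A y ∉ Φ ∧ ∀ S ∈ (Finset.range N).powerset,
      dist (GG A α G v k y S) (Rsel A α n (GG A α G v k) x S) < η := by
  have h := (Rsel_good A α G hx v k n).2.1
  set e := Rsel A α n (GG A α G v k) x
  have hU : {e' : Finset ℕ → K | ∀ S ∈ (Finset.range N).powerset, dist (e' S) (e S) < η} ∈ 𝓝 e := by
    refine (Finset.eventually_all _).2 ?_
    intro S _
    have : Tendsto (fun e' : Finset ℕ → K => dist (e' S) (e S)) (𝓝 e) (𝓝 (dist (e S) (e S))) :=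
      Continuous.tendsto (by fun_prop) e
    rw [dist_self] at this
    exact this.eventually (gt_mem_nhds (by positivity))
  have h1 := h V hV _ hU
  by_contra hcon
  push Not at hcon
  apply h1
  haveI := hΦ.countable.to_subtype
  have h2 : SmallSet A ((DD A α G)ᶜ ∪ ⋃ p : Φ, {x | A x = p}) :=
    (DD_small A α G hα hG).union (SmallSet.iUnion fun p => SmallSet.fiber A p.1)
  refine h2.mono ?_
  rintro y ⟨hy1, hy2⟩
  by_cases hyD : y ∈ DD A α G
  · right
    by_cases hyΦ : A y ∈ Φ
    · exact mem_iUnion.2 ⟨⟨A y, hyΦ⟩, rfl⟩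
    · obtain ⟨S, hS, hS'⟩ := hcon y hyD hy1 hyΦ
      have := hy2 S hS
      linarith
  · left; exact hyD

end

end core

section node
open Filter

theorem ev_le {c : ℝ} (hc : 0 < c) : ∀ᶠ δ in 𝓝[>] (0:ℝ), δ ≤ c :=
  nhdsWithin_le_nhds (Iic_mem_nhds hc)

theorem ev_pos : ∀ᶠ δ in 𝓝[>] (0:ℝ), 0 < δ := self_mem_nhdsWithin

theorem ev_ball {K : Type} [MetricSpace K] {a : K} {U : Set K} (hU : IsOpen U) (ha : a ∈ U)
    (c : ℝ) (hc : 0 < c) :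
    ∀ᶠ δ in 𝓝[>] (0:ℝ), ball a (c * δ) ⊆ U := by
  obtain ⟨r, hr, h⟩ := Metric.isOpen_iff.1 hU a ha
  filter_upwards [ev_le (div_pos hr hc)] with δ hδ
  refine (ball_subset_ball ?_).trans h
  rw [le_div_iff₀ hc] at hδ
  linarith

theorem sub_range_erase {S : Finset ℕ} {k : ℕ} (hS : S ⊆ Finset.range (k+1)) :
    S.erase k ⊆ Finset.range k := by
  intro s hs
  have h1 := Finset.ne_of_mem_erase hs
  have h2 := Finset.mem_range.1 (hS (Finset.mem_of_mem_erase hs))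
  exact Finset.mem_range.2 (by omega)

variable {Ω Y K : Type} [MetricSpace Ω] [SecondCountableTopology Ω]
    [MetricSpace Y] [MetricSpace K] [CompactSpace K]
    (A : Ω → Y) (α : K → Y) (G : Ω → K) (O : ℕ → Set K)

/-- node separation -/
def ISep (v : ℕ →₀ ℕ) (k : ℕ) (x : Ω) : Prop :=
  ∀ n ≤ k, ∀ S ⊆ Finset.range k, ∀ S' ⊆ Finset.range k, (∀ s ∈ S, n ≤ s) → (∃ s ∈ S', s < n) →
    α (GG A α G v k x S) ≠ α (GG A α G v k x S')

/-- node positivity -/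
def IPos (v : ℕ →₀ ℕ) (k : ℕ) (x : Ω) : Prop :=
  ∀ n ≤ k, ∀ S ⊆ Finset.range k, (∀ s ∈ S, n ≤ s) → ∀ j < n, GG A α G v k x S ∈ O j

theorem node_step (hα : ∀ a b, dist (α a) (α b) ≤ dist a b) (hG : ∀ x, α (G x) = A x)
    (hO : ∀ j, IsOpen (O j)) (hGO : ∀ x j, G x ∈ O j) {x : Ω} (hx : x ∈ DD A α G)
    (v : ℕ →₀ ℕ) (k : ℕ) (h1 : ISep A α G v k x) (h2 : IPos A α G O v k x) (ε : ℝ) (hε : 0 < ε) :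
    ∃ v' : ℕ →₀ ℕ, (∀ j < k, v' j = v j) ∧ ISep A α G v' (k+1) x ∧ IPos A α G O v' (k+1) x ∧
      ∀ S ⊆ Finset.range (k+1), dist (GG A α G v' (k+1) x S) (GG A α G v k x (S.erase k)) < ε := by
  set g := GG A α G v k x with hg
  have ev : ∀ᶠ δ in 𝓝[>] (0:ℝ), 0 < δ ∧ δ ≤ ε ∧
      (∀ S ∈ (Finset.range k).powerset, ∀ S' ∈ (Finset.range k).powerset, α (g S) ≠ α (g S') →
        2 * δ ≤ dist (α (g S)) (α (g S'))) ∧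
      (∀ S ∈ (Finset.range k).powerset, ∀ j ∈ Finset.range k, g S ∈ O j → ball (g S) (1 * δ) ⊆ O j) := by
    refine ev_pos.and ((ev_le hε).and (.and ?_ ?_))
    · refine (Finset.eventually_all _).2 fun S _ => (Finset.eventually_all _).2 fun S' _ => ?_
      by_cases h : α (g S) = α (g S')
      · exact Eventually.of_forall fun _ h' => absurd h h'
      · filter_upwards [ev_le (half_pos (dist_pos.2 h))] with δ hδ _
        linarith
    · refine (Finset.eventually_all _).2 fun S _ => (Finset.eventually_all _).2 fun j _ => ?_
      by_cases h : g S ∈ O j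
      · filter_upwards [ev_ball (hO j) h 1 one_pos] with δ hδ _ using hδ
      · exact Eventually.of_forall fun _ h' => absurd h' h
  obtain ⟨δ, hδ, hδε, hsep, hpos⟩ := ev.exists
  obtain ⟨n, hn⟩ := exists_near g (U := {e' | ∀ S ∈ (Finset.range k).powerset, dist (e' S) (g S) < δ})
    k δ hδ (fun e' he' => he')
  have hR := Rsel_good A α G hx v k n
  set R := Rsel A α n (GG A α G v k) x with hRd
  have hRn : ∀ S ⊆ Finset.range k, dist (R S) (g S) < δ := fun S hS =>
    hn R hR.1 S (Finset.mem_powerset.2 hS)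
  let v' := v.update k n
  have hv' : ∀ j < k, v' j = v j := by
    intro j hj
    simp [v', Function.update_of_ne (show j ≠ k by omega)]
  have hv'k : v' k = n := by simp [v']
  have hGG : ∀ S, GG A α G v' (k+1) x S = if k ∈ S then R (S.erase k) else g S := by
    intro S
    simp only [GG, hv'k, GG_congr A α G v' v k hv', R, g]
  have hC : ∀ S ⊆ Finset.range (k+1), dist (GG A α G v' (k+1) x S) (g (S.erase k)) < δ := by
    intro S hS
    rw [hGG]
    split_ifs with h
    · exact hRn _ (sub_range_erase hS)
    · rw [Finset.erase_eq_of_notMem h, dist_self]; exact hδ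
  refine ⟨v', hv', ?_, ?_, fun S hS => (hC S hS).trans_le hδε⟩
  · intro m hm S hS S' hS' hSm hSm'
    by_cases hcase : ∃ s ∈ S'.erase k, s < min m k
    · have e1 := h1 (min m k) (min_le_right _ _) _ (sub_range_erase hS) _ (sub_range_erase hS')
        (fun s hs => (min_le_left _ _).trans (hSm s (Finset.mem_of_mem_erase hs))) hcase
      have e2 := hsep _ (Finset.mem_powerset.2 (sub_range_erase hS)) _
        (Finset.mem_powerset.2 (sub_range_erase hS')) e1
      intro heq
      have c1 := (hα _ _).trans_lt (hC S hS)
      have c2 := (hα _ _).trans_lt (hC S' hS')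
      rw [heq] at c1
      have := dist_triangle_left (α (g (S.erase k))) (α (g (S'.erase k))) (α (GG A α G v' (k+1) x S'))
      linarith
    · push Not at hcase
      obtain ⟨s, hs, hsm⟩ := hSm'
      have hsk : s = k := by
        by_contra hne
        have a1 := hcase s (Finset.mem_erase.2 ⟨hne, hs⟩)
        have a2 := Finset.mem_range.1 (hS' hs)
        rcases min_le_iff.1 a1 with h | h <;> omega
      subst hsk
      have hm' : m = s + 1 := by omega
      have hSe : S = ∅ := by
        refine Finset.eq_empty_of_forall_notMem fun a ha => ?_
        have a1 := hSm a ha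
        have a2 := Finset.mem_range.1 (hS ha)
        omega
      have hSe' : S'.erase s = ∅ := by
        refine Finset.eq_empty_of_forall_notMem fun a ha => ?_
        have a1 := hcase a ha
        have a2 := Finset.mem_range.1 (sub_range_erase hS' ha)
        rcases min_le_iff.1 a1 with h | h <;> omega
      rw [hSe, GG_empty, hG, hGG, if_pos hs, hSe']
      exact hR.2.2.symm
  · intro m hm S hS hSm j hj
    rw [hGG]
    split_ifs with h
    · have hmk := hSm k h
      have e1 := h2 m hmk _ (sub_range_erase hS) (fun s hs => hSm s (Finset.mem_of_mem_erase hs)) j hj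
      refine hpos _ (Finset.mem_powerset.2 (sub_range_erase hS)) j (Finset.mem_range.2 (by omega)) e1 ?_
      rw [mem_ball, one_mul]
      exact hRn _ (sub_range_erase hS)
    · by_cases hmk : m ≤ k
      · refine h2 m hmk S ?_ hSm j hj
        have := sub_range_erase hS
        rwa [Finset.erase_eq_of_notMem h] at this
      · have hSe : S = ∅ := by
          refine Finset.eq_empty_of_forall_notMem fun a ha => ?_
          have a1 := hSm a ha
          have a2 := Finset.mem_range.1 (hS ha)
          omega
        rw [hSe, hg, GG_empty]; exact hGO _ _

theorem node_ext (hα : ∀ a b, dist (α a) (α b) ≤ dist a b) (hG : ∀ x, α (G x) = A x)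
    (hO : ∀ j, IsOpen (O j)) (hGO : ∀ x j, G x ∈ O j) {x : Ω} (hx : x ∈ DD A α G)
    (v : ℕ →₀ ℕ) (i k : ℕ) (hik : i ≤ k) (h1 : ISep A α G v i x) (h2 : IPos A α G O v i x) (ε : ℝ) (hε : 0 < ε) :
    ∃ v' : ℕ →₀ ℕ, (∀ j < i, v' j = v j) ∧ ISep A α G v' k x ∧ IPos A α G O v' k x ∧
      ∀ S ⊆ Finset.range k, dist (GG A α G v' k x S) (GG A α G v i x (S ∩ Finset.range i)) < ε := by
  induction k, hik using Nat.le_induction generalizing ε with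
  | base =>
    refine ⟨v, fun _ _ => rfl, h1, h2, fun S hS => ?_⟩
    rw [Finset.inter_eq_left.2 hS, dist_self]; exact hε
  | succ m hm ih =>
    obtain ⟨v1, a1, a2, a3, a4⟩ := ih (ε/2) (half_pos hε)
    obtain ⟨v2, b1, b2, b3, b4⟩ := node_step A α G O hα hG hO hGO hx v1 m a2 a3 (ε/2) (half_pos hε)
    refine ⟨v2, fun j hj => (b1 j (by omega)).trans (a1 j hj), b2, b3, fun S hS => ?_⟩
    have c1 := b4 S hS
    have c2 := a4 _ (sub_range_erase hS)
    have : S.erase m ∩ Finset.range i = S ∩ Finset.range i := by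
      ext s; simp only [Finset.mem_inter, Finset.mem_erase, Finset.mem_range]
      constructor
      · rintro ⟨⟨_, h⟩, h'⟩; exact ⟨h, h'⟩
      · rintro ⟨h, h'⟩; exact ⟨⟨by omega, h⟩, h'⟩
    rw [this] at c2
    have := dist_triangle (GG A α G v2 (m+1) x S) (GG A α G v1 m x (S.erase m)) (GG A α G v i x (S ∩ Finset.range i))
    linarith
end node

section stp
open Filter

theorem ev_sep {ι κ Y : Type} [MetricSpace Y] (F : Finset ι) (F' : Finset κ) (f : ι → Y) (h : κ → Y)
    (c : ℝ) (hc : 0 < c) :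
    ∀ᶠ δ in 𝓝[>] (0:ℝ), ∀ a ∈ F, ∀ b ∈ F', f a ≠ h b → c * δ ≤ dist (f a) (h b) := by
  refine (Finset.eventually_all _).2 fun S _ => (Finset.eventually_all _).2 fun S' _ => ?_
  by_cases h' : f S = h S'
  · exact Eventually.of_forall fun _ h'' => absurd h' h''
  · filter_upwards [ev_le (div_pos (dist_pos.2 h') hc)] with δ hδ _
    rw [le_div_iff₀ hc] at hδ
    linarith

theorem ev_open {ι K : Type} [MetricSpace K] (F : Finset ι) (F' : Finset ℕ) (f : ι → K) (O : ℕ → Set K)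
    (hO : ∀ j, IsOpen (O j)) (c : ℝ) (hc : 0 < c) :
    ∀ᶠ δ in 𝓝[>] (0:ℝ), ∀ a ∈ F, ∀ j ∈ F', f a ∈ O j → ball (f a) (c * δ) ⊆ O j := by
  refine (Finset.eventually_all _).2 fun S _ => (Finset.eventually_all _).2 fun j _ => ?_
  by_cases h : f S ∈ O j
  · filter_upwards [ev_ball (hO j) h c hc] with δ hδ _ using hδ
  · exact Eventually.of_forall fun _ h' => absurd h' h

theorem choose_distinct {ι Ω Y : Type} (A : Ω → Y) (F : Finset ι) (P : ι → Ω → Prop) [Nonempty Ω]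
    (h : ∀ B ∈ F, ∀ Φ : Set Y, Φ.Finite → ∃ y, P B y ∧ A y ∉ Φ) :
    ∃ y : ι → Ω, (∀ B ∈ F, P B (y B)) ∧ ∀ B ∈ F, ∀ B' ∈ F, B ≠ B' → A (y B) ≠ A (y B') := by
  classical
  induction F using Finset.induction_on with
  | empty => exact ⟨fun _ => Classical.arbitrary _, by simp, by simp⟩
  | insert a F ha ih =>
    obtain ⟨y, h1, h2⟩ := ih (fun B hB => h B (Finset.mem_insert_of_mem hB))
    obtain ⟨z, hz, hz'⟩ := h a (Finset.mem_insert_self _ _) ((fun B => A (y B)) '' F)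
      (F.finite_toSet.image _)
    have hza : ∀ B ∈ F, A z ≠ A (y B) := fun B hB he => hz' ⟨B, hB, he.symm⟩
    have hu : ∀ B ∈ F, Function.update y a z B = y B := fun B hB =>
      Function.update_of_ne (by rintro rfl; exact ha hB) _ _
    refine ⟨Function.update y a z, ?_, ?_⟩
    · intro B hB
      rcases Finset.mem_insert.1 hB with rfl | hB
      · simpa using hz
      · rw [hu B hB]; exact h1 B hB
    · intro B hB B' hB' hne
      rcases Finset.mem_insert.1 hB with rfl | hB1 <;> rcases Finset.mem_insert.1 hB' with rfl | hB2
      · exact absurd rfl hne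
      · rw [hu _ hB2]; simpa using hza _ hB2
      · rw [hu _ hB1]; simpa using (hza _ hB1).symm
      · rw [hu _ hB1, hu _ hB2]; exact h2 _ hB1 _ hB2 hne

/-- coordinate on which time `t` acts -/
def io (t : ℕ) : ℕ := (Nat.unpair t).1

theorem io_le (t : ℕ) : io t ≤ t := Nat.unpair_left_le t

/-- restriction of a node to the coordinates below `n` -/
def cut (n : ℕ) (B : Finset ℕ) : Finset ℕ := B.filter (fun τ => io τ < n)

theorem cut_erase {n t : ℕ} (h : n ≤ io t) (B : Finset ℕ) : cut n (B.erase t) = cut n B := by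
  ext s
  simp only [cut, Finset.mem_filter, Finset.mem_erase]
  constructor
  · rintro ⟨⟨_, a⟩, b⟩; exact ⟨a, b⟩
  · rintro ⟨a, b⟩; exact ⟨⟨by rintro rfl; omega, a⟩, b⟩

theorem cut_full {n t : ℕ} (h : t ≤ n) {B : Finset ℕ} (hB : B ⊆ Finset.range t) : cut n B = B := by
  rw [cut, Finset.filter_eq_self]
  intro s hs
  have := Finset.mem_range.1 (hB hs)
  have := io_le s
  omega

/-- one-step predecessor -/
def rho (t : ℕ) (p : Finset ℕ × Finset ℕ) : Finset ℕ × Finset ℕ :=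
  if t ∈ p.1 then (p.1.erase t, insert (io t) (p.2 ∩ Finset.range (io t)))
  else (p.1, p.2 ∩ Finset.range (t+1))

/-- valid pairs at time `t` -/
def PP (t : ℕ) (p : Finset ℕ × Finset ℕ) : Prop := p.1 ⊆ Finset.range t ∧ p.2 ⊆ Finset.range (t+1)

theorem sub_range_of_notMem {B : Finset ℕ} {t : ℕ} (hB : B ⊆ Finset.range (t+1)) (h : t ∉ B) :
    B ⊆ Finset.range t := by
  have := sub_range_erase hB
  rwa [Finset.erase_eq_of_notMem h] at this

theorem ins_sub {S : Finset ℕ} {i t : ℕ} (h : i ≤ t) :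
    insert i (S ∩ Finset.range i) ⊆ Finset.range (t+1) := by
  intro s hs
  simp only [Finset.mem_insert, Finset.mem_inter, Finset.mem_range] at hs ⊢
  omega

theorem rho_PP {t : ℕ} {p} (h : PP (t+1) p) : PP t (rho t p) := by
  unfold rho
  split_ifs with hp
  · exact ⟨sub_range_erase h.1, ins_sub (io_le t)⟩
  · exact ⟨sub_range_of_notMem h.1 hp, Finset.inter_subset_right⟩

variable {Ω Y K : Type} [MetricSpace Ω] [SecondCountableTopology Ω]
    [MetricSpace Y] [MetricSpace K] [CompactSpace K]
    (A : Ω → Y) (α : K → Y) (G : Ω → K) (O : ℕ → Set K)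

/-- values at a stage -/
def EE (x : Finset ℕ → Ω) (v : Finset ℕ → (ℕ →₀ ℕ)) (t : ℕ) (p : Finset ℕ × Finset ℕ) : K :=
  GG A α G (v p.1) (t+1) (x p.1) p.2

/-- good state -/
structure QGood (t : ℕ) (x : Finset ℕ → Ω) (v : Finset ℕ → (ℕ →₀ ℕ)) (η : ℝ) : Prop where
  pos : 0 < η
  dd : ∀ B ⊆ Finset.range t, x B ∈ DD A α G
  sep : ∀ n ≤ t+1, ∀ p p', PP t p → PP t p' → (∀ s ∈ p.2, n ≤ s) →
    ¬ ((∀ s ∈ p'.2, n ≤ s) ∧ cut n p'.1 = cut n p.1) →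
    8 * η ≤ dist (α (EE A α G x v t p)) (α (EE A α G x v t p'))
  opn : ∀ n ≤ t+1, ∀ p, PP t p → (∀ s ∈ p.2, n ≤ s) → ∀ j < n, ball (EE A α G x v t p) (8 * η) ⊆ O j

theorem far_ne {Y : Type} [MetricSpace Y] {a b c d : Y} {η δ : ℝ} (h : η ≤ dist a b) (h1 : dist c a ≤ δ)
    (h2 : dist d b ≤ δ) (hδ : 2 * δ < η) : c ≠ d := by
  rintro rfl
  have := dist_triangle_left a b c
  linarith

theorem state_step (hα : ∀ a b, dist (α a) (α b) ≤ dist a b) (hG : ∀ x, α (G x) = A x)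
    (hO : ∀ j, IsOpen (O j)) (hGO : ∀ x j, G x ∈ O j) (t : ℕ)
    (x : Finset ℕ → Ω) (v : Finset ℕ → (ℕ →₀ ℕ)) (η : ℝ) (hQ : QGood A α G O t x v η) :
    ∃ x' v' η', QGood A α G O (t+1) x' v' η' ∧ η' ≤ η / 2 ∧ (∀ B, t ∉ B → x' B = x B) ∧
      (∀ B ⊆ Finset.range (t+1), dist (x' B) (x (B.erase t)) ≤ η) ∧
      ∀ p, PP (t+1) p → dist (EE A α G x' v' (t+1) p) (EE A α G x v t (rho t p)) ≤ η := by
  have hη := hQ.pos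
  have hαc : Continuous α := by
    refine LipschitzWith.continuous (K := 1) (LipschitzWith.of_dist_le_mul fun a b => ?_)
    simpa using hα a b
  set i := io t with hi
  have hit : i ≤ t := io_le t
  let FB := (Finset.range t).powerset
  let FP := (Finset.range t).powerset ×ˢ (Finset.range (t+1)).powerset
  have hFP : ∀ p, p ∈ FP ↔ PP t p := fun p => by
    simp [FP, PP, Finset.mem_product, Finset.mem_powerset]
  haveI : Nonempty Ω := ⟨x ∅⟩
  -- choose the new points
  obtain ⟨y, hy, hyd⟩ := choose_distinct A FB (fun B y => y ∈ DD A α G ∧ dist y (x B) ≤ η ∧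
      (∀ p ∈ FP, A y ≠ α (EE A α G x v t p)) ∧
      ∀ S ⊆ Finset.range i, dist (GG A α G (v B) i y S) (EE A α G x v t (B, insert i S)) ≤ η/2) (by
    intro B hB Φ hΦ
    obtain ⟨z, z1, z2, z3, z4⟩ := exists_split A α G hαc hG (hQ.dd B (Finset.mem_powerset.1 hB)) (v B) i
      (v B i) (ball (x B) η) (ball_mem_nhds _ hη) i (η/2) (half_pos hη)
      (Φ ∪ (fun p => α (EE A α G x v t p)) '' FP) (hΦ.union (FP.finite_toSet.image _))
    refine ⟨z, ⟨z1, (mem_ball.1 z2).le, fun p hp he => z3 (Or.inr ⟨p, hp, he.symm⟩), fun S hS => ?_⟩,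
      fun h => z3 (Or.inl h)⟩
    have := z4 S (Finset.mem_powerset.2 hS)
    rw [EE, GG_split A α G (v B) i (t+1) (by omega) (x B) S (fun s hs => Finset.mem_range.1 (hS hs))]
    exact this.le)
  obtain ⟨θ, hθ, hθ1, hθ2⟩ := (ev_pos.and ((ev_sep FB FP (fun B => A (y B)) (fun p => α (EE A α G x v t p))
    4 (by norm_num)).and (ev_sep FB FB (fun B => A (y B)) (fun B => A (y B)) 4 (by norm_num)))).exists
  let ε := min (η/2) θ
  have hε : 0 < ε := lt_min (half_pos hη) hθ
  have hεη : ε ≤ η/2 := min_le_left _ _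
  have hεθ : ε ≤ θ := min_le_right _ _
  let x' : Finset ℕ → Ω := fun B => if t ∈ B then y (B.erase t) else x B
  have hx'1 : ∀ B, t ∈ B → x' B = y (B.erase t) := fun B h => if_pos h
  have hx'2 : ∀ B, t ∉ B → x' B = x B := fun B h => if_neg h
  have hBe : ∀ B ⊆ Finset.range (t+1), B.erase t ∈ FB := fun B hB =>
    Finset.mem_powerset.2 (sub_range_erase hB)
  have hdd' : ∀ B ⊆ Finset.range (t+1), x' B ∈ DD A α G := by
    intro B hB
    by_cases h : t ∈ B
    · rw [hx'1 B h]; exact (hy _ (hBe B hB)).1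
    · rw [hx'2 B h]; exact hQ.dd B (sub_range_of_notMem hB h)
  have hroot0 : ∀ B, ∃ v' : ℕ →₀ ℕ, B ⊆ Finset.range (t+1) → ISep A α G v' (t+1+1) (x' B) ∧
      IPos A α G O v' (t+1+1) (x' B) ∧ ∀ S ⊆ Finset.range (t+1+1),
        dist (GG A α G v' (t+1+1) (x' B) S) (if t ∈ B then GG A α G (v (B.erase t)) i (y (B.erase t))
          (S ∩ Finset.range i) else EE A α G x v t (B, S ∩ Finset.range (t+1))) < ε := by
    intro B
    by_cases hB : B ⊆ Finset.range (t+1)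
    swap
    · exact ⟨0, fun h => absurd h hB⟩
    by_cases htB : t ∈ B
    · have hyB := hy _ (hBe B hB)
      have hPP : ∀ S ⊆ Finset.range i, PP t (B.erase t, insert i S) := by
        intro S hS
        refine ⟨sub_range_erase hB, ?_⟩
        intro s hs
        rcases Finset.mem_insert.1 hs with rfl | hs
        · simp only [Finset.mem_range]; omega
        · have := Finset.mem_range.1 (hS hs); simp only [Finset.mem_range]; omega
      have hins : ∀ n ≤ i, ∀ S : Finset ℕ, (∀ s ∈ S, n ≤ s) → ∀ s ∈ insert i S, n ≤ s := by
        intro n hn S hS s hs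
        rcases Finset.mem_insert.1 hs with rfl | hs
        · exact hn
        · exact hS s hs
      obtain ⟨v', -, b2, b3, b4⟩ := node_ext A α G O hα hG hO hGO hyB.1 (v (B.erase t)) i (t+1+1) (by omega)
        (by
          intro n hn S hS S' hS' h1 h2
          have e1 := hQ.sep n (by omega) _ _ (hPP S hS) (hPP S' hS') (hins n hn S h1) (by
            rintro ⟨h3, -⟩
            obtain ⟨s, hs, hs'⟩ := h2
            have := h3 s (Finset.mem_insert_of_mem hs)
            omega)
          exact far_ne e1 ((hα _ _).trans (hyB.2.2.2 S hS)) ((hα _ _).trans (hyB.2.2.2 S' hS')) (by linarith))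
        (by
          intro n hn S hS h1 j hj
          refine hQ.opn n (by omega) _ (hPP S hS) (hins n hn S h1) j hj ?_
          rw [mem_ball]
          have := hyB.2.2.2 S hS
          linarith) ε hε
      refine ⟨v', fun _ => ?_⟩
      rw [hx'1 B htB]
      refine ⟨b2, b3, fun S hS => ?_⟩
      rw [if_pos htB]
      exact b4 S hS
    · have hB' := sub_range_of_notMem hB htB
      obtain ⟨v', -, b2, b3, b4⟩ := node_ext A α G O hα hG hO hGO (hQ.dd B hB') (v B) (t+1) (t+1+1) (by omega)
        (by
          intro n hn S hS S' hS' h1 h2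
          have e1 := hQ.sep n (by omega) (B, S) (B, S') ⟨hB', hS⟩ ⟨hB', hS'⟩ h1 (by
            rintro ⟨h3, -⟩
            obtain ⟨s, hs, hs'⟩ := h2
            have := h3 s hs
            omega)
          exact dist_pos.1 (lt_of_lt_of_le (by linarith) e1))
        (by
          intro n hn S hS h1 j hj
          exact hQ.opn n (by omega) (B, S) ⟨hB', hS⟩ h1 j hj (mem_ball_self (by linarith))) ε hε
      refine ⟨v', fun _ => ?_⟩
      rw [hx'2 B htB]
      refine ⟨b2, b3, fun S hS => ?_⟩
      rw [if_neg htB]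
      exact b4 S hS
  choose v' hv' using hroot0
  have hold : ∀ B S, PP (t+1) (B, S) → t ∉ B →
      dist (EE A α G x' v' (t+1) (B, S)) (EE A α G x v t (B, S ∩ Finset.range (t+1))) < ε := by
    intro B S h htB
    have := (hv' B h.1).2.2 S h.2
    rw [if_neg htB] at this
    exact this
  have hnew : ∀ B S, PP (t+1) (B, S) → t ∈ B →
      dist (EE A α G x' v' (t+1) (B, S)) (GG A α G (v (B.erase t)) i (y (B.erase t))
          (S ∩ Finset.range i)) < ε := by
    intro B S h htB
    have := (hv' B h.1).2.2 S h.2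
    rw [if_pos htB] at this
    exact this
  have hnew0 : ∀ B S, PP (t+1) (B, S) → t ∈ B → (∀ s ∈ S, i ≤ s) →
      dist (α (EE A α G x' v' (t+1) (B, S))) (A (y (B.erase t))) ≤ ε := by
    intro B S h htB hS
    have h1 := hnew B S h htB
    have : S ∩ Finset.range i = ∅ := by
      refine Finset.eq_empty_of_forall_notMem fun s hs => ?_
      simp only [Finset.mem_inter, Finset.mem_range] at hs
      have := hS s hs.1
      omega
    rw [this, GG_empty] at h1
    rw [← hG]
    exact (hα _ _).trans h1.le
  have hnear : ∀ p, PP (t+1) p → dist (EE A α G x' v' (t+1) p) (EE A α G x v t (rho t p)) ≤ η := by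
    rintro ⟨B, S⟩ h
    by_cases htB : t ∈ B
    · have h1 := hnew B S h htB
      have h2 := (hy _ (hBe B h.1)).2.2.2 (S ∩ Finset.range i) Finset.inter_subset_right
      have : rho t (B, S) = (B.erase t, insert i (S ∩ Finset.range i)) := if_pos htB
      rw [this]
      have := dist_triangle (EE A α G x' v' (t+1) (B, S)) (GG A α G (v (B.erase t)) i (y (B.erase t))
          (S ∩ Finset.range i)) (EE A α G x v t (B.erase t, insert i (S ∩ Finset.range i)))
      linarith
    · have h1 := hold B S h htB
      have : rho t (B, S) = (B, S ∩ Finset.range (t+1)) := if_neg htB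
      rw [this]
      linarith
  -- separation
  have hfar : ∀ n ≤ t+1, ∀ p p', PP (t+1) p → PP (t+1) p' → (∀ s ∈ (rho t p).2, n ≤ s) →
      ¬ ((∀ s ∈ (rho t p').2, n ≤ s) ∧ cut n (rho t p').1 = cut n (rho t p).1) →
      α (EE A α G x' v' (t+1) p) ≠ α (EE A α G x' v' (t+1) p') := by
    intro n hn p p' hp hp' h1 h2
    have e1 := hQ.sep n hn _ _ (rho_PP hp) (rho_PP hp') h1 h2
    exact far_ne e1 ((hα _ _).trans (hnear p hp)) ((hα _ _).trans (hnear p' hp')) (by linarith)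
  have hsep : ∀ n ≤ t+1+1, ∀ p p', PP (t+1) p → PP (t+1) p' → (∀ s ∈ p.2, n ≤ s) →
      ¬ ((∀ s ∈ p'.2, n ≤ s) ∧ cut n p'.1 = cut n p.1) →
      α (EE A α G x' v' (t+1) p) ≠ α (EE A α G x' v' (t+1) p') := by
    rintro n hn ⟨B, S⟩ ⟨B', S'⟩ hp hp' h1 h2
    simp only at h1 h2
    by_cases hBB : B = B'
    · subst hBB
      have h3 : ∃ s ∈ S', s < n := by
        by_contra hcon
        push Not at hcon
        exact h2 ⟨hcon, rfl⟩
      exact (hv' B hp.1).1 n hn S hp.2 S' hp'.2 h1 h3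
    have ro : ∀ B S, t ∉ B → rho t (B, S) = (B, S ∩ Finset.range (t+1)) := fun B S h => if_neg h
    have rn : ∀ B S, t ∈ B → rho t (B, S) = (B.erase t, insert i (S ∩ Finset.range i)) :=
      fun B S h => if_pos h
    by_cases htB : t ∈ B
    · by_cases hni : n ≤ i
      · apply hfar n (by omega) _ _ hp hp'
        · rw [rn B S htB]
          intro s hs
          rcases Finset.mem_insert.1 hs with rfl | hs
          · exact hni
          · exact h1 s (Finset.mem_inter.1 hs).1
        · rintro ⟨h3, h4⟩
          rw [rn B S htB] at h4
          apply h2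
          by_cases htB' : t ∈ B'
          · rw [rn B' S' htB'] at h3 h4
            simp only [cut_erase hni] at h4
            refine ⟨fun s hs => ?_, h4⟩
            by_contra hc
            exact hc (h3 s (Finset.mem_insert_of_mem (Finset.mem_inter.2 ⟨hs, Finset.mem_range.2 (by omega)⟩)))
          · rw [ro B' S' htB'] at h3 h4
            simp only [cut_erase hni] at h4
            refine ⟨fun s hs => ?_, h4⟩
            by_contra hc
            exact hc (h3 s (Finset.mem_inter.2 ⟨hs, Finset.mem_range.2 (by omega)⟩))
      · push Not at hni
        have g1 := hnew0 B S hp htB (fun s hs => by have := h1 s hs; omega)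
        by_cases htB' : t ∈ B'
        · by_cases hS' : ∀ s ∈ S', i ≤ s
          · have g2 := hnew0 B' S' hp' htB' hS'
            have hne : B.erase t ≠ B'.erase t := by
              intro he
              apply hBB
              rw [← Finset.insert_erase htB, he, Finset.insert_erase htB']
            have g3 := hθ2 _ (hBe B hp.1) _ (hBe B' hp'.1) (hyd _ (hBe B hp.1) _ (hBe B' hp'.1) hne)
            exact far_ne g3 g1 g2 (by linarith)
          · apply hfar i (by omega) _ _ hp hp'
            · rw [rn B S htB]
              intro s hs
              rcases Finset.mem_insert.1 hs with rfl | hs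
              · exact le_rfl
              · have := h1 s (Finset.mem_inter.1 hs).1; omega
            · rintro ⟨h3, -⟩
              apply hS'
              rw [rn B' S' htB'] at h3
              intro s hs
              by_contra hc
              exact hc (h3 s (Finset.mem_insert_of_mem (Finset.mem_inter.2 ⟨hs, Finset.mem_range.2 (by omega)⟩)))
        · have g2 := (hα _ _).trans (hold B' S' hp' htB').le
          have hP : (B', S' ∩ Finset.range (t+1)) ∈ FP := by
            rw [hFP]; exact ⟨sub_range_of_notMem hp'.1 htB', Finset.inter_subset_right⟩
          have g3 := hθ1 _ (hBe B hp.1) _ hP ((hy _ (hBe B hp.1)).2.2.1 _ hP)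
          exact far_ne g3 g1 g2 (by linarith)
    · by_cases htB' : t ∈ B'
      · by_cases hni : n ≤ i
        · apply hfar n (by omega) _ _ hp hp'
          · rw [ro B S htB]
            intro s hs
            exact h1 s (Finset.mem_inter.1 hs).1
          · rintro ⟨h3, h4⟩
            rw [ro B S htB] at h4
            apply h2
            rw [rn B' S' htB'] at h3 h4
            simp only [cut_erase hni] at h4
            refine ⟨fun s hs => ?_, h4⟩
            by_contra hc
            exact hc (h3 s (Finset.mem_insert_of_mem (Finset.mem_inter.2 ⟨hs, Finset.mem_range.2 (by omega)⟩)))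
        · apply hfar (min n (t+1)) (min_le_right _ _) _ _ hp hp'
          · rw [ro B S htB]
            intro s hs
            exact (min_le_left _ _).trans (h1 s (Finset.mem_inter.1 hs).1)
          · rintro ⟨h3, -⟩
            rw [rn B' S' htB'] at h3
            have := h3 i (Finset.mem_insert_self _ _)
            rcases min_le_iff.1 this with h | h <;> omega
      · apply hfar (min n (t+1)) (min_le_right _ _) _ _ hp hp'
        · rw [ro B S htB]
          intro s hs
          exact (min_le_left _ _).trans (h1 s (Finset.mem_inter.1 hs).1)
        · rintro ⟨h3, h4⟩
          rw [ro B S htB] at h4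
          rw [ro B' S' htB'] at h3 h4
          simp only at h4
          by_cases hnt : n ≤ t+1
          · rw [min_eq_left hnt] at h3 h4
            refine h2 ⟨fun s hs => ?_, h4⟩
            by_contra hc
            exact hc (h3 s (Finset.mem_inter.2 ⟨hs, Finset.mem_range.2 (by omega)⟩))
          · rw [min_eq_right (by omega), cut_full (by omega) (sub_range_of_notMem hp.1 htB),
              cut_full (by omega) (sub_range_of_notMem hp'.1 htB')] at h4
            exact hBB h4.symm
  let FP' := (Finset.range (t+1)).powerset ×ˢ (Finset.range (t+1+1)).powerset
  have hFP' : ∀ p, p ∈ FP' ↔ PP (t+1) p := fun p => by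
    simp only [FP', PP, Finset.mem_product, Finset.mem_powerset]
  obtain ⟨η', hη', hη'2, hs', ho'⟩ := (ev_pos.and ((ev_le (half_pos hη)).and
    ((ev_sep FP' FP' (fun p => α (EE A α G x' v' (t+1) p)) (fun p => α (EE A α G x' v' (t+1) p))
    8 (by norm_num)).and
    (ev_open FP' (Finset.range (t+1+1)) (fun p => EE A α G x' v' (t+1) p) O hO 8 (by norm_num))))).exists
  refine ⟨x', v', η', ⟨hη', hdd', ?_, ?_⟩, hη'2, hx'2, ?_, hnear⟩
  · intro n hn p p' hp hp' h1 h2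
    exact hs' p ((hFP' p).2 hp) p' ((hFP' p').2 hp') (hsep n hn p p' hp hp' h1 h2)
  · intro n hn p hp h1 j hj
    exact ho' p ((hFP' p).2 hp) j (Finset.mem_range.2 (by omega))
      ((hv' p.1 hp.1).2.1 n hn p.2 hp.2 h1 j hj)
  · intro B hB
    by_cases h : t ∈ B
    · rw [hx'1 B h]; exact (hy _ (hBe B hB)).2.1
    · rw [hx'2 B h, Finset.erase_eq_of_notMem h, dist_self]; exact hη.le

theorem state_init (hα : ∀ a b, dist (α a) (α b) ≤ dist a b) (hG : ∀ x, α (G x) = A x)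
    (hO : ∀ j, IsOpen (O j)) (hGO : ∀ x j, G x ∈ O j) (hns : ¬ SmallSet A univ) :
    ∃ x v η, QGood A α G O 0 x v η ∧ η ≤ 1 := by
  have hαc : Continuous α := by
    refine LipschitzWith.continuous (K := 1) (LipschitzWith.of_dist_le_mul fun a b => ?_)
    simpa using hα a b
  have : ∃ x0, x0 ∈ DD A α G := by
    by_contra hc
    push Not at hc
    apply hns
    exact (DD_small A α G hαc hG).mono (fun x _ => hc x)
  obtain ⟨x0, hx0⟩ := this
  obtain ⟨v0, -, b2, b3, -⟩ := node_ext A α G O hα hG hO hGO hx0 0 0 1 (by omega)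
    (by
      intro n hn S hS S' hS' h1 h2
      obtain ⟨s, hs, hs'⟩ := h2
      omega)
    (by intro n hn S hS h1 j hj; omega) 1 one_pos
  let x : Finset ℕ → Ω := fun _ => x0
  let v : Finset ℕ → (ℕ →₀ ℕ) := fun _ => v0
  let FP' := (Finset.range 0).powerset ×ˢ (Finset.range (0+1)).powerset
  have hFP' : ∀ p, p ∈ FP' ↔ PP 0 p := fun p => by
    simp only [FP', PP, Finset.mem_product, Finset.mem_powerset]
  obtain ⟨η', hη', hη'2, hs', ho'⟩ := (ev_pos.and ((ev_le one_pos).and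
    ((ev_sep FP' FP' (fun p => α (EE A α G x v 0 p)) (fun p => α (EE A α G x v 0 p))
    8 (by norm_num)).and
    (ev_open FP' (Finset.range (0+1)) (fun p => EE A α G x v 0 p) O hO 8 (by norm_num))))).exists
  refine ⟨x, v, η', ⟨hη', fun _ _ => hx0, ?_, ?_⟩, hη'2⟩
  · intro n hn p p' hp hp' h1 h2
    refine hs' p ((hFP' p).2 hp) p' ((hFP' p').2 hp') (b2 n hn p.2 hp.2 p'.2 hp'.2 h1 ?_)
    by_contra hc
    push Not at hc
    refine h2 ⟨hc, ?_⟩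
    have e1 : p.1 = ∅ := by simpa using hp.1
    have e2 : p'.1 = ∅ := by simpa using hp'.1
    rw [e1, e2]
  · intro n hn p hp h1 j hj
    exact ho' p ((hFP' p).2 hp) j (Finset.mem_range.2 (by omega)) (b3 n hn p.2 hp.2 h1 j hj)

end stp

section lim
open Filter

/-- trace of a pair below `n` -/
def Tr (n : ℕ) (p : Finset ℕ × Finset ℕ) : Finset ℕ × Finset ℕ := (cut n p.1, p.2 ∩ Finset.range n)

theorem Tr_rho {n t : ℕ} (hn : n ≤ t+1) (p : Finset ℕ × Finset ℕ) :
    Tr n (rho t p) = ((Tr n p).1.erase t,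
      if t ∈ (Tr n p).1 then insert (io t) ((Tr n p).2 ∩ Finset.range (io t)) else (Tr n p).2) := by
  obtain ⟨B, S⟩ := p
  simp only [Tr, rho]
  have hc : t ∈ cut n B ↔ t ∈ B ∧ io t < n := by simp [cut]
  refine Prod.ext ?_ ?_
  · ext s
    by_cases h : t ∈ B
    · simp only [h, if_true, cut, Finset.mem_filter, Finset.mem_erase]; tauto
    · simp only [h, if_false, cut, Finset.mem_filter, Finset.mem_erase]
      constructor
      · rintro ⟨a, b⟩; exact ⟨by rintro rfl; exact h a, a, b⟩
      · tauto
  · simp only [hc]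
    ext s
    by_cases h : t ∈ B
    · by_cases h' : io t < n
      · simp only [h, h', if_true, and_self, Finset.mem_inter, Finset.mem_insert, Finset.mem_range]
        constructor
        · rintro ⟨rfl | ⟨a, b⟩, c⟩
          · left; rfl
          · right; exact ⟨⟨a, c⟩, b⟩
        · rintro (rfl | ⟨⟨a, b⟩, c⟩)
          · exact ⟨Or.inl rfl, h'⟩
          · exact ⟨Or.inr ⟨a, c⟩, b⟩
      · simp only [h, h', if_true, and_false, if_false, Finset.mem_inter, Finset.mem_insert, Finset.mem_range]
        constructor
        · rintro ⟨rfl | ⟨a, b⟩, c⟩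
          · exact absurd c h'
          · exact ⟨a, c⟩
        · rintro ⟨a, b⟩
          exact ⟨Or.inr ⟨a, by omega⟩, b⟩
    · simp only [h, if_false, false_and, Finset.mem_inter, Finset.mem_range]
      constructor
      · rintro ⟨⟨a, b⟩, c⟩; exact ⟨a, c⟩
      · rintro ⟨a, b⟩; exact ⟨⟨a, by omega⟩, b⟩

theorem Tr_rho_iff {n t : ℕ} (hn : n ≤ t+1) (p : Finset ℕ × Finset ℕ) {σ : Finset ℕ} (hσ : t ∉ σ) :
    Tr n (rho t p) = (σ, ∅) ↔ Tr n p = (σ, ∅) := by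
  rw [Tr_rho hn]
  rcases Tr n p with ⟨C, S⟩
  simp only [Prod.mk.injEq]
  by_cases h : t ∈ C
  · simp only [h, if_true, Finset.insert_ne_empty, and_false, false_iff]
    rintro ⟨rfl, -⟩; exact hσ h
  · simp only [h, if_false, Finset.erase_eq_of_notMem h]

theorem Tr_full {t : ℕ} {p} (h : PP t p) : Tr (t+1) p = p := by
  obtain ⟨B, S⟩ := p
  exact Prod.ext (cut_full (by omega) h.1) (Finset.inter_eq_left.2 h.2)

/-- iterated predecessor -/
def rt (t : ℕ) : ℕ → Finset ℕ × Finset ℕ → Finset ℕ × Finset ℕ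
  | 0 => id
  | d + 1 => fun p => rt t d (rho (t+d) p)

theorem rt_PP (t d : ℕ) : ∀ p, PP (t+d) p → PP t (rt t d p) := by
  induction d with
  | zero => intro p h; exact h
  | succ d ih => intro p h; exact ih _ (rho_PP h)

theorem rt_Tr {n t : ℕ} (hn : n ≤ t+1) (d : ℕ) : ∀ p p', Tr n p = Tr n p' →
    Tr n (rt t d p) = Tr n (rt t d p') := by
  induction d with
  | zero => intro p p' h; exact h
  | succ d ih =>
    intro p p' h
    apply ih
    rw [Tr_rho (by omega), Tr_rho (by omega), h]

theorem rt_Tr_iff {n t : ℕ} (hn : n ≤ t+1) {σ : Finset ℕ} (hσ : σ ⊆ Finset.range t) (d : ℕ) :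
    ∀ p, Tr n (rt t d p) = (σ, ∅) ↔ Tr n p = (σ, ∅) := by
  induction d with
  | zero => intro p; exact Iff.rfl
  | succ d ih =>
    intro p
    refine (ih _).trans (Tr_rho_iff (by omega) p ?_)
    intro h
    have := Finset.mem_range.1 (hσ h)
    omega

theorem Tr_snd_empty {n : ℕ} {p : Finset ℕ × Finset ℕ} (h : (Tr n p).2 = ∅) : ∀ s ∈ p.2, n ≤ s := by
  intro s hs
  by_contra hc
  have : s ∈ (Tr n p).2 := Finset.mem_inter.2 ⟨hs, Finset.mem_range.2 (by omega)⟩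
  rw [h] at this
  simp at this

theorem Tr_of {n : ℕ} {p : Finset ℕ × Finset ℕ} {σ} (h : ∀ s ∈ p.2, n ≤ s) (h' : cut n p.1 = σ) :
    Tr n p = (σ, ∅) := by
  refine Prod.ext h' (Finset.eq_empty_of_forall_notMem fun s hs => ?_)
  have h1 := h s (Finset.mem_inter.1 hs).1
  have h2 := Finset.mem_range.1 (Finset.mem_inter.1 hs).2
  omega

/-- node of `b` at time `t` -/
def Bt (b : ℕ → ℕ) (t : ℕ) : Finset ℕ :=
  (Finset.range t).filter (fun τ => b (Nat.unpair τ).1 = (Nat.unpair τ).2 + 1)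

/-- trace of the eventual node of `b` -/
def sg (b : ℕ → ℕ) (n : ℕ) : Finset ℕ :=
  ((Finset.range n).filter (fun j => b j ≠ 0)).image (fun j => Nat.pair j (b j - 1))

theorem mem_sg {b : ℕ → ℕ} {n τ : ℕ} :
    τ ∈ sg b n ↔ io τ < n ∧ b (Nat.unpair τ).1 = (Nat.unpair τ).2 + 1 := by
  simp only [sg, Finset.mem_image, Finset.mem_filter, Finset.mem_range, io]
  constructor
  · rintro ⟨j, ⟨h1, h2⟩, rfl⟩
    simp only [Nat.unpair_pair]
    exact ⟨h1, by omega⟩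
  · rintro ⟨h1, h2⟩
    refine ⟨_, ⟨h1, by omega⟩, ?_⟩
    rw [h2, Nat.add_sub_cancel, Nat.pair_unpair]

theorem cut_Bt (b : ℕ → ℕ) (n t : ℕ) : cut n (Bt b t) = sg b n ∩ Finset.range t := by
  ext τ
  simp only [cut, Bt, Finset.mem_filter, Finset.mem_inter, mem_sg]
  tauto

theorem cut_Bt_full {b : ℕ → ℕ} {n t : ℕ} (h : sg b n ⊆ Finset.range t) : cut n (Bt b t) = sg b n := by
  rw [cut_Bt, Finset.inter_eq_left.2 h]

theorem sg_congr {b b' : ℕ → ℕ} {n : ℕ} (h : ∀ j < n, b j = b' j) : sg b n = sg b' n := by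
  ext τ
  rw [mem_sg, mem_sg]
  constructor
  · rintro ⟨h1, h2⟩; exact ⟨h1, (h _ h1).symm.trans h2⟩
  · rintro ⟨h1, h2⟩; exact ⟨h1, (h _ h1).trans h2⟩

theorem sg_inj {b b' : ℕ → ℕ} {n : ℕ} (h : sg b n = sg b' n) : ∀ j < n, b j = b' j := by
  intro j hj
  have key : ∀ m, b j = m + 1 ↔ b' j = m + 1 := by
    intro m
    have h1 : Nat.pair j m ∈ sg b n ↔ Nat.pair j m ∈ sg b' n := by rw [h]
    simpa [mem_sg, io, hj] using h1
  rcases hb : b j with _ | m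
  · rcases hb' : b' j with _ | m
    · rfl
    · have := (key m).2 hb'; omega
  · exact ((key m).1 hb).symm

theorem Bt_erase (b : ℕ → ℕ) (t : ℕ) : (Bt b (t+1)).erase t = Bt b t := by
  ext τ
  simp only [Bt, Finset.mem_erase, Finset.mem_filter, Finset.mem_range]
  constructor
  · rintro ⟨h1, h2, h3⟩; exact ⟨by omega, h3⟩
  · rintro ⟨h1, h2⟩; exact ⟨by omega, by omega, h2⟩

theorem Bt_sub (b : ℕ → ℕ) (t : ℕ) : Bt b t ⊆ Finset.range t := Finset.filter_subset _ _

theorem Bt_PP (b : ℕ → ℕ) (t : ℕ) : PP t (Bt b t, ∅) := ⟨Bt_sub b t, by simp⟩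

theorem exists_T (b : ℕ → ℕ) (n : ℕ) : ∃ T, n ≤ T ∧ sg b n ⊆ Finset.range T := by
  refine ⟨n + (sg b n).sup id + 1, by omega, fun s hs => ?_⟩
  have : s ≤ (sg b n).sup id := Finset.le_sup (f := id) hs
  exact Finset.mem_range.2 (by omega)

variable {Ω Y K : Type} [MetricSpace Ω] [SecondCountableTopology Ω]
    [MetricSpace Y] [MetricSpace K] [CompactSpace K]
    (A : Ω → Y) (α : K → Y) (G : Ω → K) (O : ℕ → Set K)

theorem exists_seq (hα : ∀ a b, dist (α a) (α b) ≤ dist a b) (hG : ∀ x, α (G x) = A x)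
    (hO : ∀ j, IsOpen (O j)) (hGO : ∀ x j, G x ∈ O j) (hns : ¬ SmallSet A univ) :
    ∃ (X : ℕ → Finset ℕ → Ω) (V : ℕ → Finset ℕ → (ℕ →₀ ℕ)) (η : ℕ → ℝ),
      (∀ t, QGood A α G O t (X t) (V t) (η t)) ∧ η 0 ≤ 1 ∧ (∀ t, η (t+1) ≤ η t / 2) ∧
      (∀ t, ∀ B ⊆ Finset.range (t+1), dist (X (t+1) B) (X t (B.erase t)) ≤ η t) ∧
      ∀ t p, PP (t+1) p →
        dist (EE A α G (X (t+1)) (V (t+1)) (t+1) p) (EE A α G (X t) (V t) t (rho t p)) ≤ η t := by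
  let ST := fun t : ℕ => {s : (Finset ℕ → Ω) × (Finset ℕ → (ℕ →₀ ℕ)) × ℝ // QGood A α G O t s.1 s.2.1 s.2.2}
  obtain ⟨x0, v0, e0, h0, h01⟩ := state_init A α G O hα hG hO hGO hns
  have hstep : ∀ t (s : ST t), ∃ s' : ST (t+1), s'.1.2.2 ≤ s.1.2.2 / 2 ∧
      (∀ B ⊆ Finset.range (t+1), dist (s'.1.1 B) (s.1.1 (B.erase t)) ≤ s.1.2.2) ∧
      ∀ p, PP (t+1) p → dist (EE A α G s'.1.1 s'.1.2.1 (t+1) p) (EE A α G s.1.1 s.1.2.1 t (rho t p)) ≤ s.1.2.2 := by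
    rintro t ⟨⟨x, v, e⟩, hs⟩
    obtain ⟨x', v', e', h1, h2, -, h3, h4⟩ := state_step A α G O hα hG hO hGO t x v e hs
    exact ⟨⟨⟨x', v', e'⟩, h1⟩, h2, h3, h4⟩
  choose nx hnx using hstep
  let s : ∀ t, ST t := fun t => Nat.rec (motive := ST) ⟨⟨x0, v0, e0⟩, h0⟩ (fun t s => nx t s) t
  refine ⟨fun t => (s t).1.1, fun t => (s t).1.2.1, fun t => (s t).1.2.2, fun t => (s t).2, h01,
    fun t => (hnx t (s t)).1, fun t => (hnx t (s t)).2.1, fun t => (hnx t (s t)).2.2⟩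

theorem core_limit (hα : ∀ a b, dist (α a) (α b) ≤ dist a b) (hG : ∀ x, α (G x) = A x)
    (hO : ∀ j, IsOpen (O j)) (hGO : ∀ x j, G x ∈ O j) (hns : ¬ SmallSet A univ) :
    ∃ (X : ℕ → Finset ℕ → Ω) (η : ℕ → ℝ) (γ : (ℕ → ℕ) → K),
      (∀ t, 0 < η t) ∧ Tendsto η atTop (𝓝 0) ∧
      (∀ b t s, t ≤ s → dist (X s (Bt b s)) (X t (Bt b t)) ≤ 2 * η t) ∧
      (∀ b, Tendsto (fun t => G (X t (Bt b t))) atTop (𝓝 (γ b))) ∧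
      (∀ b j, γ b ∈ O j) ∧
      (∀ n b b', (∀ j < n+1, b j = b' j) → dist (γ b) (γ b') ≤ 4 * η n) ∧
      ∀ b n, ∃ δ > 0, ∀ b', (∃ j < n, b j ≠ b' j) → δ ≤ dist (α (γ b)) (α (γ b')) := by
  obtain ⟨X, V, η, hQ, h01, hhalf, hX, hE⟩ := exists_seq A α G O hα hG hO hGO hns
  have hpos : ∀ t, 0 < η t := fun t => (hQ t).pos
  have hαc : Continuous α := by
    refine LipschitzWith.continuous (K := 1) (LipschitzWith.of_dist_le_mul fun a b => ?_)
    simpa using hα a b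
  have hpow : ∀ t, η t ≤ (1/2)^t := by
    intro t
    induction t with
    | zero => simpa using h01
    | succ t ih => have := hhalf t; rw [pow_succ]; linarith
  have hlim : Tendsto η atTop (𝓝 0) :=
    squeeze_zero (fun t => (hpos t).le) hpow (tendsto_pow_atTop_nhds_zero_of_lt_one (by norm_num) (by norm_num))
  have hξ : ∀ b t d, dist (X (t+d) (Bt b (t+d))) (X t (Bt b t)) ≤ 2 * η t - 2 * η (t+d) := by
    intro b t d
    induction d with
    | zero => simp
    | succ d ih =>
      have h1 := hX (t+d) (Bt b (t+d+1)) (Bt_sub _ _)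
      rw [Bt_erase] at h1
      have h2 := hhalf (t+d)
      have h3 := dist_triangle (X (t+d+1) (Bt b (t+d+1))) (X (t+d) (Bt b (t+d))) (X t (Bt b t))
      rw [← add_assoc]
      linarith
  let E := fun t p => EE A α G (X t) (V t) t p
  have hrt : ∀ t d p, PP (t+d) p → dist (E (t+d) p) (E t (rt t d p)) ≤ 2 * η t - 2 * η (t+d) := by
    intro t d
    induction d with
    | zero => intro p _; simp [rt]
    | succ d ih =>
      intro p hp
      have h1 := hE (t+d) p hp
      have h2 := ih _ (rho_PP hp)
      have h3 := hhalf (t+d)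
      have h4 := dist_triangle (E (t+d+1) p) (E (t+d) (rho (t+d) p)) (E t (rt t d (rho (t+d) p)))
      rw [← add_assoc]
      change dist (E (t+d+1) p) (E t (rt t d (rho (t+d) p))) ≤ _
      change dist (E (t+d+1) p) (E (t+d) (rho (t+d) p)) ≤ _ at h1
      linarith
  have hrt' : ∀ t s, t ≤ s → ∀ p, PP s p → PP t (rt t (s-t) p) ∧ dist (E s p) (E t (rt t (s-t) p)) ≤ 2 * η t := by
    intro t s hts p hp
    obtain ⟨d, rfl⟩ := Nat.exists_eq_add_of_le hts
    rw [Nat.add_sub_cancel_left]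
    refine ⟨rt_PP t d p hp, ?_⟩
    have := hrt t d p hp
    have := hpos (t+d)
    linarith
  have hL1 : ∀ t s, t ≤ s → ∀ p p', PP s p → PP s p' → Tr (t+1) p = Tr (t+1) p' →
      dist (E s p) (E s p') ≤ 4 * η t := by
    intro t s hts p p' hp hp' h
    obtain ⟨a1, a2⟩ := hrt' t s hts p hp
    obtain ⟨b1, b2⟩ := hrt' t s hts p' hp'
    have h1 := rt_Tr le_rfl (s-t) p p' h
    rw [Tr_full a1, Tr_full b1] at h1
    rw [h1] at a2
    have := dist_triangle_right (E s p) (E s p') (E t (rt t (s-t) p'))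
    linarith
  have hEG : ∀ b t, E t (Bt b t, ∅) = G (X t (Bt b t)) := fun b t => GG_empty A α G _ _ _
  have hTrB : ∀ b n t, sg b n ⊆ Finset.range t → Tr n (Bt b t, ∅) = (sg b n, ∅) := by
    intro b n t h
    exact Tr_of (by simp) (cut_Bt_full h)
  have hmono : ∀ {σ : Finset ℕ} {s t : ℕ}, s ≤ t → σ ⊆ Finset.range s → σ ⊆ Finset.range t :=
    fun h h' => h'.trans (Finset.range_mono h)
  have hanti : Antitone η := antitone_nat_of_succ_le fun t => by
    have := hhalf t; have := hpos t; linarith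
  have hC : ∀ b, CauchySeq (fun t => G (X t (Bt b t))) := by
    intro b
    rw [Metric.cauchySeq_iff']
    intro ε hε
    have h1 : ∀ᶠ t in atTop, η t < ε / 6 := hlim.eventually (gt_mem_nhds (by positivity))
    obtain ⟨t, ht⟩ := h1.exists
    obtain ⟨T, hT, hσ⟩ := exists_T b (t+1)
    refine ⟨T, fun s hs => ?_⟩
    have c1 := hrt' T s hs _ (Bt_PP b s)
    have c2 := (rt_Tr_iff (n := t+1) (t := T) (by omega) hσ (s-T) (Bt b s, ∅)).2 (hTrB b (t+1) s (hmono hs hσ))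
    have c3 := hL1 t T (by omega) _ _ c1.1 (Bt_PP b T) (c2.trans (hTrB b (t+1) T hσ).symm)
    rw [← hEG, ← hEG]
    have := dist_triangle (E s (Bt b s, ∅)) (E T (rt T (s-T) (Bt b s, ∅))) (E T (Bt b T, ∅))
    have := hanti (show t ≤ T by omega)
    linarith [c1.2]
  have hγ : ∀ b, ∃ z, Tendsto (fun t => G (X t (Bt b t))) atTop (𝓝 z) := fun b =>
    cauchySeq_tendsto_of_complete (hC b)
  choose γ hγ using hγ
  refine ⟨X, η, γ, hpos, hlim, ?_, hγ, ?_, ?_, ?_⟩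
  · intro b t s hts
    obtain ⟨d, rfl⟩ := Nat.exists_eq_add_of_le hts
    have := hξ b t d
    have := hpos (t+d)
    linarith
  · intro b j
    obtain ⟨T, hT, hσ⟩ := exists_T b (j+1)
    have h1 := Metric.tendsto_atTop.1 (hγ b) (η T) (hpos T)
    obtain ⟨N, hN⟩ := h1
    have h2 := hN (max N T) (le_max_left _ _)
    set s := max N T
    have hs : T ≤ s := le_max_right _ _
    have c1 := hrt' T s hs _ (Bt_PP b s)
    have c2 := (rt_Tr_iff (n := j+1) (t := T) (by omega) hσ (s-T) (Bt b s, ∅)).2 (hTrB b (j+1) s (hmono hs hσ))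
    refine (hQ T).opn (j+1) (by omega) _ c1.1 (Tr_snd_empty (by rw [c2])) j (by omega) ?_
    rw [mem_ball]
    rw [← hEG] at h2
    have := dist_triangle_left (γ b) (E T (rt T (s-T) (Bt b s, ∅))) (E s (Bt b s, ∅))
    have h3 := hpos T
    change dist (γ b) (E T (rt T (s-T) (Bt b s, ∅))) < _
    linarith [c1.2]
  · intro n b b' h
    refine le_of_tendsto ((hγ b).dist (hγ b')) ?_
    filter_upwards [eventually_ge_atTop n] with s hs
    rw [← hEG, ← hEG]
    refine hL1 n s hs _ _ (Bt_PP b s) (Bt_PP b' s) ?_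
    simp only [Tr, cut_Bt, sg_congr h]
  · intro b n
    obtain ⟨T, hT, hσ⟩ := exists_T b n
    refine ⟨4 * η T, by have := hpos T; positivity, fun b' hb' => ?_⟩
    obtain ⟨T', hT', hσ'⟩ := exists_T b' n
    refine ge_of_tendsto (((hαc.tendsto _).comp (hγ b)).dist ((hαc.tendsto _).comp (hγ b'))) ?_
    filter_upwards [eventually_ge_atTop (max T T')] with s hs
    have hs1 : T ≤ s := (le_max_left _ _).trans hs
    have hs2 : T' ≤ s := (le_max_right _ _).trans hs
    have c1 := hrt' T s hs1 _ (Bt_PP b s)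
    have c2 := (rt_Tr_iff (n := n) (t := T) (by omega) hσ (s-T) (Bt b s, ∅)).2 (hTrB b n s (hmono hs1 hσ))
    have d1 := hrt' T s hs1 _ (Bt_PP b' s)
    have d2 : Tr n (rt T (s-T) (Bt b' s, ∅)) ≠ (sg b n, ∅) := by
      rw [Ne, rt_Tr_iff (n := n) (t := T) (by omega) hσ, hTrB b' n s (hmono hs2 hσ')]
      intro he
      obtain ⟨j, hj, hne⟩ := hb'
      exact hne (sg_inj (Prod.ext_iff.1 he).1.symm j hj)
    have e1 := (hQ T).sep n (by omega) _ _ c1.1 d1.1 (Tr_snd_empty (by rw [c2])) (by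
      rintro ⟨h1, h2⟩
      apply d2
      refine Tr_of h1 (h2.trans ?_)
      exact (Prod.ext_iff.1 c2).1)
    simp only [Function.comp]
    rw [← hEG, ← hEG]
    change 8 * η T ≤ dist (α (E T (rt T (s-T) (Bt b s, ∅)))) (α (E T (rt T (s-T) (Bt b' s, ∅)))) at e1
    have f1 := (hα _ _).trans c1.2
    have f2 := (hα _ _).trans d1.2
    rw [dist_comm] at f1
    have g1 := dist_triangle4 (α (E T (rt T (s-T) (Bt b s, ∅)))) (α (E s (Bt b s, ∅))) (α (E s (Bt b' s, ∅)))
      (α (E T (rt T (s-T) (Bt b' s, ∅))))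
    linarith

end lim

section fin
open Filter

/-- Baire space with the Cantor topology -/
def CB : Type := ℕ → ℕ

instance : TopologicalSpace CB := cantorTop

/-- the inducing map -/
def CBmap (s : CB) (n : ℕ) : ℝ := cantorEmbNat (s n)

theorem CBmap_ind : IsInducing CBmap := ⟨rfl⟩

theorem cantorEmb_succ (n : ℕ) : cantorEmbNat (n+1) = (1/2)^(n+1) := by
  simp only [cantorEmbNat, Nat.add_eq_zero_iff, one_ne_zero, and_false, if_false]
  rw [zpow_neg, zpow_natCast, one_div, inv_pow]

theorem cantorEmb_tendsto : Tendsto cantorEmbNat atTop (𝓝 0) := by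
  rw [← tendsto_add_atTop_iff_nat 1]
  simp only [cantorEmb_succ]
  exact (tendsto_add_atTop_iff_nat 1).2 (tendsto_pow_atTop_nhds_zero_of_lt_one (by norm_num) (by norm_num))

instance : CompactSpace CB := by
  refine ⟨?_⟩
  rw [CBmap_ind.isCompact_iff, image_univ]
  have h1 : IsCompact (range cantorEmbNat) := by
    have := cantorEmb_tendsto.isCompact_insert_range
    have h0 : (0:ℝ) ∈ range cantorEmbNat := ⟨0, by simp [cantorEmbNat]⟩
    rwa [insert_eq_of_mem h0] at this
  have h2 : range CBmap = Set.pi univ (fun _ => range cantorEmbNat) := by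
    ext z
    constructor
    · rintro ⟨s, rfl⟩ n _
      exact ⟨s n, rfl⟩
    · intro h
      choose s hs using fun n => h n trivial
      exact ⟨s, funext hs⟩
  rw [h2]
  exact isCompact_univ_pi fun _ => h1

theorem CB_eventually (b : CB) (i m : ℕ) : ∀ᶠ b' : CB in 𝓝 b, (b' i = m + 1 ↔ b i = m + 1) := by
  have hc : Continuous (fun b : CB => cantorEmbNat (b i)) := (continuous_apply i).comp CBmap_ind.continuous
  have hlt : ∀ a b : ℕ, a < b → ((1:ℝ)/2)^b < (1/2)^a := fun a b h =>
    pow_lt_pow_right_of_lt_one₀ (by norm_num) (by norm_num) h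
  have hU : ∀ n, cantorEmbNat n ∈ Ioo (((1:ℝ)/2)^(m+2)) ((1/2)^m) ↔ n = m+1 := by
    intro n
    rcases n with _ | n
    · refine ⟨fun h => absurd h.1 (not_lt.2 ?_), fun h => by omega⟩
      have : cantorEmbNat 0 = 0 := by simp [cantorEmbNat]
      rw [this]; positivity
    · rw [cantorEmb_succ, mem_Ioo, pow_lt_pow_iff_right_of_lt_one₀ (by norm_num) (by norm_num),
        pow_lt_pow_iff_right_of_lt_one₀ (by norm_num) (by norm_num)]
      omega
  have hS : ∀ n, cantorEmbNat n ∈ ({((1:ℝ)/2)^(m+1)}ᶜ : Set ℝ) ↔ n ≠ m+1 := by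
    intro n
    rcases n with _ | n
    · refine ⟨fun _ => by omega, fun _ => ?_⟩
      have : cantorEmbNat 0 = 0 := by simp [cantorEmbNat]
      rw [this]
      exact (by positivity : (0:ℝ) < (1/2)^(m+1)).ne
    · rw [cantorEmb_succ, mem_compl_iff, mem_singleton_iff,
        pow_right_inj₀ (by norm_num) (by norm_num)]
  by_cases h : b i = m+1
  · have : ∀ᶠ b' : CB in 𝓝 b, cantorEmbNat (b' i) ∈ Ioo (((1:ℝ)/2)^(m+2)) ((1/2)^m) :=
      hc.continuousAt.eventually (isOpen_Ioo.mem_nhds ((hU _).2 h))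
    filter_upwards [this] with b' hb'
    exact ⟨fun _ => h, fun _ => (hU _).1 hb'⟩
  · have : ∀ᶠ b' : CB in 𝓝 b, cantorEmbNat (b' i) ∈ ({((1:ℝ)/2)^(m+1)}ᶜ : Set ℝ) :=
      hc.continuousAt.eventually (isOpen_compl_singleton.mem_nhds ((hS _).2 h))
    filter_upwards [this] with b' hb'
    exact ⟨fun h' => absurd h' ((hS _).1 hb'), fun h' => absurd h' h⟩

theorem CB_Bt (b : CB) (t : ℕ) : ∀ᶠ b' : CB in 𝓝 b, Bt b' t = Bt b t := by
  have : ∀ᶠ b' : CB in 𝓝 b, ∀ τ ∈ Finset.range t,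
      (b' (Nat.unpair τ).1 = (Nat.unpair τ).2 + 1 ↔ b (Nat.unpair τ).1 = (Nat.unpair τ).2 + 1) :=
    (Finset.eventually_all _).2 fun τ _ => CB_eventually b _ _
  filter_upwards [this] with b' hb'
  exact Finset.filter_congr hb'

theorem dich_core {H C : Type} [MetricSpace H] [CompactSpace H] [MetricSpace C] [CompactSpace C]
    (c : (ℕ → ℕ) → C) (hc : IsEmbedding c) (O : ℕ → Set C) (hO : ∀ j, IsOpen (O j))
    (hcO : ⋂ j, O j = range c)
    (Ad : Set H) (A : Ad → H) (f : (ℕ → ℕ) → H × H) (hf : Continuous f)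
    (hf1 : ∀ x : Ad, ∃ w, f w = (x.1, A x)) (hf2 : ∀ w, ∃ x : Ad, f w = (x.1, A x))
    (hns : ¬ SmallSet A univ) :
    ∃ φd φdd : (ℕ → ℕ) → H, (∀ s, ∃ x : Ad, φd s = x.1 ∧ φdd s = A x) ∧
      @IsEmbedding (ℕ → ℕ) H cantorTop _ φd ∧ IsEmbedding φdd := by
  choose yy hyy using hf1
  have hmem : ∀ w j, c w ∈ O j := by
    intro w j
    have : c w ∈ ⋂ j, O j := by rw [hcO]; exact ⟨w, rfl⟩
    exact mem_iInter.1 this j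
  obtain ⟨X, η, γ, hpos, hlim, hξ, hγ, hγO, hcl, hsep⟩ := core_limit A (Prod.fst : H × C → H)
    (fun x => (A x, c (yy x))) (fun j => Prod.snd ⁻¹' (O j))
    (fun a b => by rw [Prod.dist_eq]; exact le_max_left _ _) (fun _ => rfl)
    (fun j => (hO j).preimage continuous_snd) (fun x j => hmem _ j) hns
  have hΦ : ∀ b, ∃ x : Ad, Tendsto (fun t => X t (Bt b t)) atTop (𝓝 x) ∧ (γ b).1 = A x := by
    intro b
    have h1 : (γ b).2 ∈ range c := by
      rw [← hcO]; exact mem_iInter.2 (hγO b)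
    obtain ⟨w, hw⟩ := h1
    have h2 : Tendsto (fun t => yy (X t (Bt b t))) atTop (𝓝 w) := by
      rw [hc.isInducing.tendsto_nhds_iff, hw]
      exact (continuous_snd.tendsto _).comp (hγ b)
    have h3 := (hf.tendsto w).comp h2
    obtain ⟨x, hx⟩ := hf2 w
    have h4 : Tendsto (fun t => ((X t (Bt b t)).1, A (X t (Bt b t)))) atTop (𝓝 (x.1, A x)) := by
      rw [← hx]
      refine h3.congr fun t => ?_
      simp [hyy]
    refine ⟨x, ?_, ?_⟩
    · rw [tendsto_subtype_rng]
      exact (continuous_fst.tendsto _).comp h4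
    · exact tendsto_nhds_unique ((continuous_fst.tendsto _).comp (hγ b)) ((continuous_snd.tendsto _).comp h4)
  choose Φ hΦ1 hΦ2 using hΦ
  have hinj : Function.Injective (fun b => (γ b).1) := by
    intro b b' h
    funext j
    by_contra hne
    obtain ⟨δ, hδ, h1⟩ := hsep b (j+1)
    have h2 := h1 b' ⟨j, by omega, hne⟩
    simp only at h
    rw [h, dist_self] at h2
    linarith
  refine ⟨fun b => (Φ b).1, fun b => (γ b).1, fun b => ⟨Φ b, rfl, hΦ2 b⟩, ?_, ?_⟩
  · have hcont : Continuous (fun b : CB => Φ b) := by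
      have hu : TendstoUniformly (fun t (b : CB) => X t (Bt b t)) (fun b : CB => Φ b) atTop := by
        rw [Metric.tendstoUniformly_iff]
        intro ε hε
        have h1 : ∀ᶠ t in atTop, η t < ε / 2 := hlim.eventually (gt_mem_nhds (by positivity))
        filter_upwards [h1] with t ht b
        have : dist (Φ b) (X t (Bt b t)) ≤ 2 * η t := by
          refine le_of_tendsto ((hΦ1 b).dist tendsto_const_nhds) ?_
          filter_upwards [eventually_ge_atTop t] with s hs using hξ b t s hs
        linarith
      refine hu.continuous (Frequently.of_forall fun t => ?_)
      rw [continuous_iff_continuousAt]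
      intro b
      refine ContinuousAt.congr (f := fun _ => X t (Bt b t)) continuousAt_const ?_
      filter_upwards [CB_Bt b t] with b' hb'
      rw [hb']
    have hcont2 : Continuous (fun b : CB => (Φ b).1) := continuous_subtype_val.comp hcont
    have hi : Function.Injective (fun b : CB => (Φ b).1) := by
      intro b b' h
      refine hinj ((hΦ2 b).trans (Eq.trans ?_ (hΦ2 b').symm))
      exact congrArg A (Subtype.ext h)
    exact (hcont2.isClosedEmbedding hi).isEmbedding
  · refine ⟨isInducing_iff_nhds.2 fun b => le_antisymm ?_ ?_, hinj⟩
    · rw [← tendsto_iff_comap]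
      rw [Metric.tendsto_nhds]
      intro ε hε
      have h1 : ∀ᶠ t in atTop, η t < ε / 4 := hlim.eventually (gt_mem_nhds (by positivity))
      obtain ⟨n, hn⟩ := h1.exists
      have h2 : ∀ᶠ b' in 𝓝 b, ∀ j ∈ Finset.range (n+1), b' j = b j := by
        refine (Finset.eventually_all _).2 fun j _ => ?_
        have := (continuous_apply j).tendsto b
        rw [nhds_discrete ℕ] at this
        exact tendsto_pure.1 this
      filter_upwards [h2] with b' hb'
      have h3 := hcl n b' b (fun j hj => hb' j (Finset.mem_range.2 hj))
      have h4 : dist (γ b').1 (γ b).1 ≤ dist (γ b') (γ b) := by rw [Prod.dist_eq]; exact le_max_left _ _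
      linarith
    · have : Tendsto (fun b' : ℕ → ℕ => b') (comap (fun b => (γ b).1) (𝓝 (γ b).1)) (𝓝 b) := by
        rw [tendsto_pi_nhds]
        intro j
        rw [nhds_discrete ℕ, tendsto_pure]
        obtain ⟨δ, hδ, h1⟩ := hsep b (j+1)
        refine (eventually_comap.2 ?_)
        filter_upwards [ball_mem_nhds (γ b).1 hδ] with z hz b' hb'
        by_contra hne
        have h2 := h1 b' ⟨j, by omega, fun h => hne h.symm⟩
        rw [mem_ball, dist_comm, ← hb'] at hz
        linarith
      exact this

theorem dich_top {H : Type} [TopologicalSpace H] [TopologicalSpace.MetrizableSpace H] [CompactSpace H]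
    (Ad : Set H) (A : Ad → H) (f : (ℕ → ℕ) → H × H) (hf : Continuous f)
    (hf1 : ∀ x : Ad, ∃ w, f w = (x.1, A x)) (hf2 : ∀ w, ∃ x : Ad, f w = (x.1, A x))
    (hns : ¬ SmallSet A univ) :
    ∃ φd φdd : (ℕ → ℕ) → H, (∀ s, ∃ x : Ad, φd s = x.1 ∧ φdd s = A x) ∧
      @IsEmbedding (ℕ → ℕ) H cantorTop _ φd ∧ IsEmbedding φdd := by
  letI : MetricSpace H := TopologicalSpace.metrizableSpaceMetric H
  have hc : IsEmbedding (Pi.map (fun _ : ℕ => (Nat.cast : ℕ → ℕ∞))) :=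
    IsEmbedding.piMap (fun _ => ENat.isEmbedding_natCast)
  have hO : ∀ j : ℕ, IsOpen {z : ℕ → ℕ∞ | z j ≠ ⊤} := fun j =>
    isOpen_compl_singleton.preimage (continuous_apply j)
  have hcO : ⋂ j : ℕ, {z : ℕ → ℕ∞ | z j ≠ ⊤} = range (Pi.map (fun _ : ℕ => (Nat.cast : ℕ → ℕ∞))) := by
    ext z
    simp only [mem_iInter, mem_setOf_eq, mem_range]
    constructor
    · intro h
      refine ⟨fun j => (z j).toNat, ?_⟩
      funext j
      exact ENat.coe_toNat (h j)
    · rintro ⟨w, rfl⟩ j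
      exact ENat.coe_ne_top _
  letI : MetricSpace (ℕ → ℕ∞) := TopologicalSpace.metrizableSpaceMetric (ℕ → ℕ∞)
  exact dich_core (H := H) (C := ℕ → ℕ∞) _ hc _ hO hcO Ad A f hf hf1 hf2 hns

end fin


/-- Solecki-type dichotomy for functions with analytic graphs (Theorem 1 of the paper):
either the graph can be covered by countably many graphs of continuous functions, or it
contains a copy of the Pawlikowski function `P` (the identity from `ω^ω` with the Cantor
topology to `ω^ω` with the Baire topology). -/
theorem analytic_graph_dichotomy
    (Adot Addot : Set Hcube) (hAdot : AnalyticSet Adot) (hAddot : AnalyticSet Addot)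
    (A : Set (Hcube × Hcube))
    (hsub : A ⊆ Adot ×ˢ Addot)
    (hfun : ∀ x ∈ Adot, ∃! y : Hcube, (x, y) ∈ A)
    (hAanal : AnalyticSet A) :
    CoveredByCtsGraphs A ∨
      ∃ (φd φdd : (ℕ → ℕ) → Hcube),
        (∀ s, (φd s, φdd s) ∈ A) ∧
        (∀ s, φd s ∈ Adot) ∧ (∀ s, φdd s ∈ Addot) ∧
        (@Topology.IsEmbedding (ℕ → ℕ) Hcube cantorTop _ φd) ∧
        Topology.IsEmbedding φdd := by
  have hF : ∀ x : Hcube, ∃ y : Hcube, x ∈ Adot → (x, y) ∈ A := by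
    intro x
    by_cases h : x ∈ Adot
    · obtain ⟨y, hy, -⟩ := hfun x h
      exact ⟨y, fun _ => hy⟩
    · exact ⟨x, fun h' => absurd h' h⟩
  choose F hF using hF
  have huniq : ∀ x y, (x, y) ∈ A → x ∈ Adot ∧ y = F x := by
    intro x y h
    have hx : x ∈ Adot := (hsub h).1
    exact ⟨hx, (hfun x hx).unique h (hF x hx)⟩
  by_cases hs : SmallSet (fun x : Adot => F x.1) univ
  · left
    obtain ⟨E, hE1, hE2⟩ := hs
    refine ⟨fun n => {p | p.1 ∈ Subtype.val '' (E n) ∧ p.2 = F p.1}, fun n => ⟨_, F, ?_, rfl⟩, ?_⟩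
    · exact (IsInducing.subtypeVal.continuousOn_image_iff).2 (hE2 n)
    · rintro ⟨x, y⟩ h
      obtain ⟨hx, hy⟩ := huniq x y h
      obtain ⟨n, hn⟩ := mem_iUnion.1 (hE1 (mem_univ (⟨x, hx⟩ : Adot)))
      exact mem_iUnion.2 ⟨n, ⟨⟨x, hx⟩, hn, rfl⟩, hy⟩
  · rw [AnalyticSet] at hAanal
    rcases hAanal with rfl | ⟨f, hf, hfr⟩
    · left
      exact ⟨fun _ => ∅, fun _ => ⟨∅, id, continuousOn_empty _, by simp⟩, by simp⟩
    · right
      obtain ⟨φd, φdd, h1, h2, h3⟩ := dich_top Adot (fun x => F x.1) f hf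
        (fun x => by
          have : (x.1, F x.1) ∈ range f := by rw [hfr]; exact hF x.1 x.2
          exact this)
        (fun w => by
          have h : f w ∈ A := by rw [← hfr]; exact ⟨w, rfl⟩
          obtain ⟨hx, hy⟩ := huniq (f w).1 (f w).2 h
          exact ⟨⟨_, hx⟩, Prod.ext rfl hy⟩) hs
      have hmem : ∀ s, (φd s, φdd s) ∈ A := by
        intro s
        obtain ⟨x, e1, e2⟩ := h1 s
        rw [e1, e2]
        exact hF x.1 x.2
      exact ⟨φd, φdd, hmem, fun s => (hsub (hmem s)).1, fun s => (hsub (hmem s)).2, h2, h3⟩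

end
end

section
/- Let A ⊆ Ḣ × Ḧ be the graph of a function and let X ⊆ A be analytic and I-positive. Then there exists an I-positive set Y ⊆ X such that Y is relatively closed in X and Y ⊆_nwd X, i.e., the projection Ẏ of Y onto Ḣ is contained in the closure of Ẋ \ Ẏ. -/
open MeasureTheory Metric Set Topology

noncomputable section

/-- Lemma 1(2): if `X ⊆ A` is analytic and `I`-positive, where `A` is the graph of a
function, then there is an `I`-positive `Y ⊆ X` which is relatively closed in `X` and
satisfies `Y ⊆_nwd X`, i.e. the first projection `Ẏ` is contained in `cl(Ẋ \ Ẏ)`. -/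
theorem exists_I_positive_relatively_closed_nwd
    (A : Set (Hcube × Hcube))
    (hgraph : ∀ x y y' : Hcube, (x, y) ∈ A → (x, y') ∈ A → y = y')
    (X : Set (Hcube × Hcube)) (hXA : X ⊆ A)
    (hXanal : AnalyticSet X) (hpos : ¬ CoveredByCtsGraphs X) :
    ∃ Y : Set (Hcube × Hcube), Y ⊆ X ∧ ¬ CoveredByCtsGraphs Y ∧
      (∃ C : Set (Hcube × Hcube), IsClosed C ∧ Y = X ∩ C) ∧
      Prod.fst '' Y ⊆ closure (Prod.fst '' X \ Prod.fst '' Y) := by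
  classical
  have hf : ∀ x : Hcube, ∃ y, ∀ y', (x, y') ∈ X → y' = y := by
    intro x
    by_cases h : ∃ y, (x, y) ∈ X
    · obtain ⟨y, hy⟩ := h
      exact ⟨y, fun y' hy' => hgraph x y' y (hXA hy') (hXA hy)⟩
    · exact ⟨fun _ => 0, fun y' hy' => (h ⟨y', hy'⟩).elim⟩
  choose f hf using hf
  obtain ⟨b, hbc, -, hb⟩ := TopologicalSpace.exists_countable_basis Hcube
  have hbne : b.Nonempty := by
    obtain ⟨V, hV, -⟩ := hb.exists_subset_of_mem_open (mem_univ (fun _ => 0 : Hcube)) isOpen_univ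
    exact ⟨V, hV⟩
  obtain ⟨B, rfl⟩ := hbc.exists_eq_range hbne
  let O : ℕ → Set Hcube := fun n =>
    ⋃₀ {W | IsOpen W ∧ ∀ p ∈ X, p.1 ∈ W → p.2 ∈ closure (B n)}
  have hO : ∀ n, IsOpen (O n) := fun n => isOpen_sUnion fun W hW => hW.1
  let C : ℕ → Set (Hcube × Hcube) := fun n =>
    (Prod.snd ⁻¹' closure (B n)) ∩ (Prod.fst ⁻¹' (O n))ᶜ
  have hC : ∀ n, IsClosed (C n) := fun n =>
    (isClosed_closure.preimage continuous_snd).inter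
      ((hO n).preimage continuous_fst).isClosed_compl
  by_cases hall : ∀ n, CoveredByCtsGraphs (X ∩ C n)
  · exfalso
    apply hpos
    choose G hG hGc using hall
    let D : Set Hcube := {x | (x, f x) ∈ X ∧ ∀ n, (x, f x) ∉ C n}
    have hD : ContinuousOn f D := by
      intro x hx
      intro U hU
      obtain ⟨V, ⟨n, rfl⟩, hxV, hVU⟩ := hb.exists_closure_subset hU
      have hxO : x ∈ O n := by
        by_contra h
        exact hx.2 n ⟨subset_closure hxV, h⟩
      obtain ⟨W, ⟨hWo, hW⟩, hxW⟩ := hxO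
      have h1 : W ∩ D ∈ 𝓝[D] x :=
        Filter.inter_mem (mem_nhdsWithin_of_mem_nhds (hWo.mem_nhds hxW)) self_mem_nhdsWithin
      refine Filter.mem_map.2 (Filter.mem_of_superset h1 ?_)
      intro z hz
      exact hVU (hW _ hz.2.1 hz.1)
    refine ⟨fun k => if k = 0 then {p | p.1 ∈ D ∧ p.2 = f p.1}
      else G (k - 1).unpair.1 (k - 1).unpair.2, ?_, ?_⟩
    · intro k
      dsimp only
      split_ifs
      · exact ⟨D, f, hD, rfl⟩
      · exact hG _ _
    · rintro ⟨x, y⟩ hp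
      have hy : y = f x := hf x y hp
      rw [mem_iUnion]
      by_cases h : ∀ n, (x, f x) ∉ C n
      · refine ⟨0, ?_⟩
        rw [if_pos rfl]
        exact ⟨⟨hy ▸ hp, h⟩, hy⟩
      · push Not at h
        obtain ⟨n, hn⟩ := h
        obtain ⟨m, hm⟩ := mem_iUnion.1 (hGc n ⟨hp, hy ▸ hn⟩)
        refine ⟨Nat.pair n m + 1, ?_⟩
        simpa using hm
  · push Not at hall
    obtain ⟨n, hn⟩ := hall
    refine ⟨X ∩ C n, inter_subset_left, hn, ⟨C n, hC n, rfl⟩, ?_⟩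
    rintro _ ⟨⟨x, y⟩, ⟨hX, hCn⟩, rfl⟩
    rw [_root_.mem_closure_iff]
    intro W hW hxW
    by_contra hne
    apply hCn.2
    refine ⟨W, ⟨hW, ?_⟩, hxW⟩
    rintro ⟨z, w⟩ hp hzW
    by_contra hw
    apply hne
    refine ⟨z, hzW, ⟨_, hp, rfl⟩, ?_⟩
    rintro ⟨⟨z', w'⟩, ⟨hX', hC'⟩, h⟩
    obtain rfl : z' = z := h
    have : w' = w := hgraph _ _ _ (hXA hX') (hXA hp)
    subst this
    exact hw hC'.1

end
end

section
/- Let ε > 0 and let Ẋ be a nonempty subset of the Hilbert cube Ḣ. Then there exists K ∈ ℕ such that for every sequence ⟨Ẋ_k : k < K⟩ of subsets of Ẋ with the property that for all k ≠ k' < K the set Ẋ_k ∪ Ẋ_{k'} is dense in Ẋ, there is some k < K with Hausdorff distance |Ẋ_k, Ẋ| < ε. -/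
open MeasureTheory Metric Set Topology

noncomputable section

attribute [local instance] PiCountable.metricSpace

/-- Lemma 2: for every `ε > 0` and every nonempty `Ẋ ⊆ Ḣ` there is `K ∈ ℕ` such that
for every sequence `⟨Ẋ_k : k < K⟩` of subsets of `Ẋ` any two of which have dense union
in `Ẋ`, some `Ẋ_k` is at Hausdorff distance `< ε` from `Ẋ`. -/
theorem exists_K_of_pairwise_dense_unions
    (ε : ℝ) (hε : 0 < ε) (X : Set Hcube) (hX : X.Nonempty) :
    ∃ K : ℕ, ∀ Xk : ℕ → Set Hcube,
      (∀ k < K, Xk k ⊆ X) →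
      (∀ k < K, ∀ k' < K, k ≠ k' → X ⊆ closure (Xk k ∪ Xk k')) →
      ∃ k < K, hausdorffDist (Xk k) X < ε := by
  have htb : TotallyBounded X := isCompact_univ.totallyBounded.subset (subset_univ X)
  obtain ⟨t, htX, htf, hcov⟩ := totallyBounded_iff_subset.1 htb _
    (Metric.dist_mem_uniformity (show 0 < ε / 4 by linarith))
  refine ⟨htf.toFinset.card + 1, fun Xk hsub hdense => ?_⟩
  have key : ∃ k < htf.toFinset.card + 1, ∀ y ∈ t, ∃ z ∈ Xk k, dist y z < ε / 4 := by
    by_contra! hcon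
    have hcon' : ∀ k, ∃ y, k < htf.toFinset.card + 1 →
        y ∈ t ∧ ∀ z ∈ Xk k, ε / 4 ≤ dist y z := by
      intro k
      by_cases hk : k < htf.toFinset.card + 1
      · obtain ⟨y, hy⟩ := hcon k hk
        exact ⟨y, fun _ => hy⟩
      · exact ⟨hX.some, fun h => absurd h hk⟩
    choose f hf using hcon'
    obtain ⟨a, ha, b, hb, hab, hfab⟩ :=
      Finset.exists_ne_map_eq_of_card_lt_of_maps_to
        (s := Finset.range (htf.toFinset.card + 1)) (t := htf.toFinset) (f := f)
        (by simp) (by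
          intro k hk
          simpa using (hf k (by simpa using hk)).1)
    have ha' := Finset.mem_range.1 ha
    have hb' := Finset.mem_range.1 hb
    have hm := hdense a ha' b hb' hab (htX (hf a ha').1)
    obtain ⟨z, hz, hd⟩ := Metric.mem_closure_iff.1 hm (ε / 4) (by linarith)
    rcases hz with hz | hz
    · exact absurd hd (not_lt.2 ((hf a ha').2 z hz))
    · rw [hfab] at hd
      exact absurd hd (not_lt.2 ((hf b hb').2 z hz))
  obtain ⟨k, hk, hkey⟩ := key
  refine ⟨k, hk, lt_of_le_of_lt (Metric.hausdorffDist_le_of_mem_dist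
    (r := ε / 2) (by linarith) ?_ ?_) (by linarith)⟩
  · intro x hx
    exact ⟨x, hsub k hk hx, by rw [dist_self]; linarith⟩
  · intro x hx
    obtain ⟨y, hy, hxy⟩ := mem_iUnion₂.1 (hcov hx)
    obtain ⟨z, hz, hyz⟩ := hkey y hy
    have hxy' : dist x y < ε / 4 := hxy
    exact ⟨z, hz, by linarith [dist_triangle x y z]⟩

end
end

section
/- Let X̃ be a cylinder with base X ⊆ Ḣ × Ḧ. Then every analytic set Y ⊆ X can be unfolded to a cylinder Ỹ ⊆ X̃, i.e., there exists a cylinder Ỹ with base Y such that Ỹ ⊆ X̃. -/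
open MeasureTheory Metric Set Topology

noncomputable section

/-- The unfolding space `(ω^ω)^ω × Ḣ × Ḧ`; the projection `π` onto `Ḣ × Ḧ` is
`Prod.snd`. -/
abbrev UnfSp : Type := (ℕ → ℕ → ℕ) × (Hcube × Hcube)

/-- `X̃` is a cylinder with base `X`: a closed subset of `(ω^ω)^ω × Ḣ × Ḧ` projecting
onto `X` such that for some `N < ω`, membership `(s, x) ∈ X̃` depends only on `x` and
`s↾N`. -/
def IsCylinder (Xt : Set UnfSp) (X : Set (Hcube × Hcube)) : Prop :=
  IsClosed Xt ∧ Prod.snd '' Xt = X ∧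
    ∃ N : ℕ, ∀ x ∈ X, ∀ r s : ℕ → ℕ → ℕ,
      (∀ i < N, s i = r i) → (s, x) ∈ Xt → (r, x) ∈ Xt

/-- Lemma 4(a): given a cylinder `X̃` with base `X`, every analytic `Y ⊆ X` can be
unfolded to a cylinder `Ỹ ⊆ X̃`. -/
theorem unfold_analytic_subset_of_cylinder
    (Xt : Set UnfSp) (X : Set (Hcube × Hcube)) (hcyl : IsCylinder Xt X)
    (Y : Set (Hcube × Hcube)) (hYX : Y ⊆ X) (hY : AnalyticSet Y) :
    ∃ Yt : Set UnfSp, Yt ⊆ Xt ∧ IsCylinder Yt Y := by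
  obtain ⟨hcl, hproj, N, hN⟩ := hcyl
  rw [AnalyticSet] at hY
  rcases hY with rfl | ⟨f, hf, rfl⟩
  · exact ⟨∅, empty_subset _, isClosed_empty, by simp, 0, by simp⟩
  refine ⟨Xt ∩ {p | f (p.1 N) = p.2}, inter_subset_left, ?_, ?_, N + 1, ?_⟩
  · refine hcl.inter (isClosed_eq ?_ continuous_snd)
    exact hf.comp ((continuous_apply N).comp continuous_fst)
  · apply Subset.antisymm
    · rintro _ ⟨p, ⟨_, hp⟩, rfl⟩
      exact ⟨p.1 N, hp⟩
    · rintro _ ⟨t, rfl⟩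
      have hx : f t ∈ X := hYX ⟨t, rfl⟩
      have hx' := hx
      rw [← hproj] at hx'
      obtain ⟨⟨s, y⟩, hs, hy⟩ := hx'
      simp only at hy
      subst hy
      refine ⟨(Function.update s N t, f t), ⟨hN _ hx _ s ?_ hs, by simp⟩, rfl⟩
      intro i hi
      rw [Function.update_of_ne hi.ne]
  · rintro x hx r s hrs ⟨h1, h2⟩
    refine ⟨hN x (hYX hx) r s (fun i hi => hrs i (by omega)) h1, ?_⟩
    have h3 := hrs N (by omega)
    simp only [mem_setOf_eq] at h2 ⊢
    rw [← h3, h2]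

end
end

section
/- Let A ⊆ Ḣ × Ḧ be the graph of a function, let X̃ be a solid cylinder with base X ⊆ A, let Y ⊆ X be analytic and I-positive, and let ε > 0. Then there exists a solid set Z ⊆_nwd Y that can be unfolded to a cylinder Z̃ ⊆ X̃ with diameter |Z̃| < ε. -/
open MeasureTheory Metric Set Topology

noncomputable section

attribute [local instance] PiCountable.metricSpace

/-- A nonempty analytic `X ⊆ A` is solid if every relatively open nonempty piece of it
is `I`-positive. -/
def Solid (A X : Set (Hcube × Hcube)) : Prop :=
  X.Nonempty ∧ AnalyticSet X ∧ X ⊆ A ∧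
    ∀ U : Set (Hcube × Hcube), IsOpen U → U ∩ X = ∅ ∨ ¬ CoveredByCtsGraphs (U ∩ X)

theorem Cov.mono {X Y : Set (Hcube × Hcube)} (h : X ⊆ Y) (hY : CoveredByCtsGraphs Y) :
    CoveredByCtsGraphs X := by
  obtain ⟨G, hG, hc⟩ := hY
  exact ⟨G, hG, h.trans hc⟩

theorem Cov.iUnion {T : ℕ → Set (Hcube × Hcube)} (h : ∀ n, CoveredByCtsGraphs (T n)) :
    CoveredByCtsGraphs (⋃ n, T n) := by
  choose G hG hc using h
  refine ⟨fun k => G k.unpair.1 k.unpair.2, fun k => hG _ _, ?_⟩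
  intro p hp
  obtain ⟨n, hn⟩ := mem_iUnion.1 hp
  obtain ⟨m, hm⟩ := mem_iUnion.1 (hc n hn)
  refine mem_iUnion.2 ⟨Nat.pair n m, ?_⟩
  simpa using hm

theorem Cov.empty : CoveredByCtsGraphs ∅ :=
  ⟨fun _ => ∅, fun _ => ⟨∅, fun x => x, continuousOn_empty _, by simp⟩, by simp⟩

theorem Cov.biUnion {ι : Type} {S : Set ι} (hS : S.Countable) {T : ι → Set (Hcube × Hcube)}
    (h : ∀ i ∈ S, CoveredByCtsGraphs (T i)) : CoveredByCtsGraphs (⋃ i ∈ S, T i) := by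
  rcases S.eq_empty_or_nonempty with rfl | hne
  · simpa using Cov.empty
  · obtain ⟨f, rfl⟩ := hS.exists_eq_range hne
    rw [biUnion_range]
    exact Cov.iUnion fun n => h _ (mem_range_self n)

theorem Cov.union {X Y : Set (Hcube × Hcube)} (hX : CoveredByCtsGraphs X)
    (hY : CoveredByCtsGraphs Y) : CoveredByCtsGraphs (X ∪ Y) := by
  refine Cov.mono (Y := ⋃ n : ℕ, if n = 0 then X else Y) ?_ (Cov.iUnion ?_)
  · rintro p (hp | hp)
    · exact mem_iUnion.2 ⟨0, by simpa using hp⟩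
    · exact mem_iUnion.2 ⟨1, by simpa using hp⟩
  · intro n
    split_ifs <;> assumption

theorem exists_nwd (Y : Set (Hcube × Hcube))
    (hgraph : ∀ x y y' : Hcube, (x, y) ∈ Y → (x, y') ∈ Y → y = y')
    (hYpos : ¬ CoveredByCtsGraphs Y) :
    ∃ C : Set (Hcube × Hcube), IsClosed C ∧ ¬ CoveredByCtsGraphs (Y ∩ C) ∧
      Prod.fst '' (Y ∩ C) ⊆ closure (Prod.fst '' Y \ Prod.fst '' (Y ∩ C)) := by
  let b := TopologicalSpace.countableBasis Hcube
  let C : Set Hcube → Set (Hcube × Hcube) := fun V =>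
    {p | p.2 ∈ closure V ∧ p.1 ∈ closure (Prod.fst '' {q ∈ Y | q.2 ∉ closure V})}
  have hC : ∀ V, IsClosed (C V) := fun V =>
    (isClosed_closure.preimage continuous_snd).inter (isClosed_closure.preimage continuous_fst)
  have key : ∃ V ∈ b, ¬ CoveredByCtsGraphs (Y ∩ C V) := by
    by_contra! hcon
    apply hYpos
    let R := Y \ ⋃ V ∈ b, Y ∩ C V
    have hR : CoveredByCtsGraphs R := by
      have : ∀ x : Hcube, ∃ y : Hcube, x ∈ Prod.fst '' R → (x, y) ∈ R := by
        intro x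
        by_cases hx : x ∈ Prod.fst '' R
        · obtain ⟨⟨x, y⟩, h, rfl⟩ := hx
          exact ⟨y, fun _ => h⟩
        · exact ⟨x, fun h => absurd h hx⟩
      choose f hf using this
      refine ⟨fun _ => {p | p.1 ∈ Prod.fst '' R ∧ p.2 = f p.1}, fun _ => ⟨_, f, ?_, rfl⟩, ?_⟩
      · intro x hx
        rw [ContinuousWithinAt, Filter.tendsto_def]
        intro N hN
        obtain ⟨V, hVb, hxV, hVN⟩ :=
          (TopologicalSpace.isBasis_countableBasis Hcube).exists_closure_subset hN
        have hxR := hf x hx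
        have hxn : x ∉ closure (Prod.fst '' {q ∈ Y | q.2 ∉ closure V}) := by
          intro hcl
          exact hxR.2 (mem_iUnion₂.2 ⟨V, hVb, hxR.1, subset_closure hxV, hcl⟩)
        have h1 : (closure (Prod.fst '' {q ∈ Y | q.2 ∉ closure V}))ᶜ ∈ 𝓝 x :=
          isClosed_closure.isOpen_compl.mem_nhds hxn
        filter_upwards [mem_nhdsWithin_of_mem_nhds h1, self_mem_nhdsWithin] with z hz hzD
        apply hVN
        by_contra hzV
        exact hz (subset_closure ⟨(z, f z), ⟨(hf z hzD).1, hzV⟩, rfl⟩)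
      · intro p hp
        have hpD : p.1 ∈ Prod.fst '' R := ⟨p, hp, rfl⟩
        exact mem_iUnion.2 ⟨0, hpD, hgraph p.1 _ _ hp.1 (hf _ hpD).1⟩
    refine Cov.mono ?_ (Cov.union hR
      (Cov.biUnion (TopologicalSpace.countable_countableBasis Hcube) hcon))
    intro p hp
    by_cases h : p ∈ ⋃ V ∈ b, Y ∩ C V
    · exact Or.inr h
    · exact Or.inl ⟨hp, h⟩
  obtain ⟨V, -, hV⟩ := key
  refine ⟨C V, hC V, hV, ?_⟩
  rintro _ ⟨p, hp, rfl⟩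
  refine closure_mono ?_ hp.2.2
  rintro _ ⟨q, hq, rfl⟩
  refine ⟨⟨q, hq.1, rfl⟩, ?_⟩
  rintro ⟨q', hq', he⟩
  apply hq.2
  have h2 : q.2 = q'.2 := hgraph q.1 _ _ hq.1 (he ▸ hq'.1)
  rw [h2]
  exact hq'.2.1

theorem exists_solid (T : Set (Hcube × Hcube)) (hpos : ¬ CoveredByCtsGraphs T) :
    ∃ C : Set (Hcube × Hcube), IsClosed C ∧ (T ∩ C).Nonempty ∧
      ∀ U : Set (Hcube × Hcube), IsOpen U →
        U ∩ (T ∩ C) = ∅ ∨ ¬ CoveredByCtsGraphs (U ∩ (T ∩ C)) := by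
  let S := {U ∈ TopologicalSpace.countableBasis (Hcube × Hcube) | CoveredByCtsGraphs (U ∩ T)}
  have hS : S.Countable := (TopologicalSpace.countable_countableBasis _).mono (sep_subset _ _)
  have hOc : CoveredByCtsGraphs (⋃ U ∈ S, U ∩ T) := Cov.biUnion hS fun U hU => hU.2
  let O := ⋃ U ∈ S, U
  have hO : IsOpen O := isOpen_biUnion fun U hU =>
    TopologicalSpace.isOpen_of_mem_countableBasis hU.1
  have hsub : T ∩ O ⊆ ⋃ U ∈ S, U ∩ T := by
    rintro p ⟨hp, hpO⟩
    obtain ⟨U, hU, hpU⟩ := mem_iUnion₂.1 hpO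
    exact mem_iUnion₂.2 ⟨U, hU, hpU, hp⟩
  refine ⟨Oᶜ, hO.isClosed_compl, ?_, ?_⟩
  · by_contra hne
    rw [not_nonempty_iff_eq_empty] at hne
    apply hpos
    refine Cov.mono (fun p hp => hsub ⟨hp, ?_⟩) hOc
    by_contra h
    have : p ∈ T ∩ Oᶜ := ⟨hp, h⟩
    rw [hne] at this
    exact this
  · intro U hU
    by_contra! hcon
    obtain ⟨⟨p, hpU, hpT, hpO⟩, hc⟩ := hcon
    obtain ⟨B, hB, hpB, hBU⟩ :=
      (TopologicalSpace.isBasis_countableBasis (Hcube × Hcube)).exists_subset_of_mem_open hpU hU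
    apply hpO
    refine mem_iUnion₂.2 ⟨B, ⟨hB, Cov.mono ?_ (Cov.union hc hOc)⟩, hpB⟩
    rintro q ⟨hqB, hqT⟩
    by_cases hq : q ∈ O
    · exact Or.inr (hsub ⟨hqT, hq⟩)
    · exact Or.inl ⟨hBU hqB, hqT, hq⟩

theorem exists_small_nhd (δ : ℝ) (hδ : 0 < δ) (q : UnfSp) :
    ∃ D : Set UnfSp, D ∈ 𝓝 q ∧ IsClosed D ∧ D ⊆ closedBall q δ ∧
      ∃ M : ℕ, ∀ x, ∀ r s : ℕ → ℕ → ℕ, (∀ i < M, s i = r i) → (s, x) ∈ D → (r, x) ∈ D := by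
  have h1 : ball q.1 δ ∈ 𝓝 q.1 := ball_mem_nhds _ hδ
  rw [nhds_pi, Filter.mem_pi] at h1
  obtain ⟨I, hI, t, ht, hsub⟩ := h1
  have ht' : ∀ i, ∃ u ⊆ t i, IsClosed u ∧ u ∈ 𝓝 (q.1 i) := by
    intro i
    obtain ⟨u, hu, hm, hs⟩ := exists_mem_nhds_isClosed_subset (ht i)
    exact ⟨u, hs, hm, hu⟩
  choose u hut huc hum using ht'
  obtain ⟨M, hM⟩ := hI.bddAbove
  refine ⟨(I.pi u) ×ˢ closedBall q.2 δ, ?_, ?_, ?_, M + 1, ?_⟩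
  · exact prod_mem_nhds (set_pi_mem_nhds hI fun i _ => hum i)
      (closedBall_mem_nhds _ hδ)
  · exact (isClosed_set_pi fun i _ => huc i).prod isClosed_closedBall
  · rintro ⟨s, x⟩ ⟨hs, hx⟩
    have := hsub (fun i hi => hut i (hs i hi))
    rw [mem_closedBall, Prod.dist_eq]
    exact max_le (mem_ball.1 this).le hx
  · rintro x r s hrs ⟨hs, hx⟩
    refine ⟨fun i hi => ?_, hx⟩
    have : s i = r i := hrs i (Nat.lt_succ_of_le (hM hi))
    have h2 : s i ∈ u i := hs i hi
    rw [this] at h2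
    exact h2

/-- Lemma 4(b): given `ε > 0`, a solid cylinder `X̃` with base `X ⊆ A` and an analytic
`I`-positive `Y ⊆ X`, there is a solid `Z ⊆_nwd Y` that can be unfolded to a cylinder
`Z̃ ⊆ X̃` of diameter `< ε`. -/
theorem exists_small_solid_subcylinder
    (A : Set (Hcube × Hcube))
    (hgraph : ∀ x y y' : Hcube, (x, y) ∈ A → (x, y') ∈ A → y = y')
    (Xt : Set UnfSp) (X : Set (Hcube × Hcube))
    (hcyl : IsCylinder Xt X) (hsolid : Solid A X)
    (Y : Set (Hcube × Hcube)) (hYX : Y ⊆ X)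
    (hYanal : AnalyticSet Y) (hYpos : ¬ CoveredByCtsGraphs Y)
    (ε : ℝ) (hε : 0 < ε) :
    ∃ Z : Set (Hcube × Hcube), Solid A Z ∧ Z ⊆ Y ∧
      Prod.fst '' Z ⊆ closure (Prod.fst '' Y \ Prod.fst '' Z) ∧
      ∃ Zt : Set UnfSp, Zt ⊆ Xt ∧ IsCylinder Zt Z ∧ Metric.diam Zt < ε := by
  obtain ⟨C, hC, hCpos, hnwd⟩ := exists_nwd Y
    (fun x y y' h h' => hgraph x y y' (hsolid.2.2.1 (hYX h)) (hsolid.2.2.1 (hYX h'))) hYpos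
  obtain ⟨hXc, hXp, N, hN⟩ := hcyl
  obtain ⟨g, hg, hgY⟩ : ∃ g : (ℕ → ℕ) → Hcube × Hcube, Continuous g ∧ range g = Y := by
    rw [AnalyticSet] at hYanal
    rcases hYanal with h | h
    · exact absurd (h ▸ Cov.empty) hYpos
    · exact h
  let W : Set UnfSp := Xt ∩ {p | g (p.1 N) = p.2} ∩ Prod.snd ⁻¹' C
  have hWc : IsClosed W := by
    refine (hXc.inter (isClosed_eq ?_ continuous_snd)).inter (hC.preimage continuous_snd)
    exact hg.comp ((continuous_apply N).comp continuous_fst)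
  have hWY : Prod.snd '' W ⊆ Y ∩ C := by
    rintro _ ⟨p, hp, rfl⟩
    refine ⟨?_, hp.2⟩
    rw [← hgY]
    exact ⟨_, hp.1.2⟩
  have hYW : Y ∩ C ⊆ Prod.snd '' W := by
    rintro x ⟨hxY, hxC⟩
    have hxX := hYX hxY
    have hx' := hxX
    rw [← hXp] at hx'
    obtain ⟨⟨s, _⟩, hs, rfl⟩ := hx'
    rw [← hgY] at hxY
    obtain ⟨a, ha⟩ := hxY
    refine ⟨(Function.update s N a, _), ⟨⟨hN _ hxX _ s ?_ hs, ?_⟩, hxC⟩, rfl⟩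
    · intro i hi
      rw [Function.update_of_ne hi.ne]
    · simpa using ha
  have hWN : ∀ x, ∀ r s : ℕ → ℕ → ℕ, (∀ i < N + 1, s i = r i) → (s, x) ∈ W → (r, x) ∈ W := by
    rintro x r s hrs ⟨⟨h1, h2⟩, h3⟩
    refine ⟨⟨hN x ?_ r s (fun i hi => hrs i (by omega)) h1, ?_⟩, h3⟩
    · rw [← hXp]
      exact ⟨_, h1, rfl⟩
    · have h4 : g (s N) = x := h2
      rw [hrs N (by omega)] at h4
      exact h4
  choose D hDn hDc hDb M hM using exists_small_nhd (ε / 4) (by positivity)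
  obtain ⟨S, hS, hSu⟩ := TopologicalSpace.countable_cover_nhds hDn
  obtain ⟨q, -, hq⟩ : ∃ q ∈ S, ¬ CoveredByCtsGraphs (Prod.snd '' (W ∩ D q)) := by
    by_contra! hcon
    apply hCpos
    refine Cov.mono (hYW.trans ?_) (Cov.biUnion hS hcon)
    rintro _ ⟨p, hp, rfl⟩
    have : p ∈ ⋃ x ∈ S, D x := hSu ▸ mem_univ p
    obtain ⟨q, hqS, hpq⟩ := mem_iUnion₂.1 this
    exact mem_iUnion₂.2 ⟨q, hqS, p, ⟨hp, hpq⟩, rfl⟩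
  obtain ⟨E, hE, hEne, hEs⟩ := exists_solid _ hq
  have hcl : IsClosed (W ∩ D q ∩ Prod.snd ⁻¹' E) :=
    (hWc.inter (hDc q)).inter (hE.preimage continuous_snd)
  have himg : Prod.snd '' (W ∩ D q ∩ Prod.snd ⁻¹' E) = Prod.snd '' (W ∩ D q) ∩ E :=
    image_inter_preimage _ _ _
  have hZYC : Prod.snd '' (W ∩ D q) ∩ E ⊆ Y ∩ C := fun p hp =>
    hWY (image_mono inter_subset_left hp.1)
  refine ⟨Prod.snd '' (W ∩ D q) ∩ E, ⟨hEne, ?_, ?_, hEs⟩, fun p hp => (hZYC hp).1, ?_,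
    W ∩ D q ∩ Prod.snd ⁻¹' E, fun p hp => hp.1.1.1.1, ⟨hcl, himg, max (N + 1) (M q), ?_⟩, ?_⟩
  · rw [← himg]
    exact hcl.analyticSet.image_of_continuous continuous_snd
  · exact fun p hp => hsolid.2.2.1 (hYX (hZYC hp).1)
  · refine (image_mono hZYC).trans (hnwd.trans (closure_mono ?_))
    exact sdiff_subset_sdiff_right (image_mono hZYC)
  · rintro x - r s hrs ⟨⟨h1, h2⟩, h3⟩
    exact ⟨⟨hWN x r s (fun i hi => hrs i (lt_max_of_lt_left hi)) h1,
      hM q x r s (fun i hi => hrs i (lt_max_of_lt_right hi)) h2⟩, h3⟩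
  · have hb : W ∩ D q ∩ Prod.snd ⁻¹' E ⊆ closedBall q (ε / 4) := fun p hp => hDb q hp.1.2
    calc Metric.diam _ ≤ 2 * (ε / 4) :=
          (diam_mono hb isBounded_closedBall).trans (diam_closedBall (by positivity))
      _ < ε := by linarith

end
end
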